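/- arXiv:1006.3614 — 3 statements merged into one kernel-verified Lean document; each statement's English description precedes it below -/
import Mathlib

section
/- For any n×n unitary matrices U and V, Σ_{j=1}^n |Arg(λ_j^↓(UV))| ≤ Σ_{j=1}^n |Arg(λ_j(U))| + Σ_{j=1}^n |Arg(λ_j(V))|, where Arg denotes principal argument in (−π, π] and the sums run over all eigenvalues counted with multiplicity. -/
open Complex Matrix

noncomputable def absArgs {m : Type*} [Fintype m] [DecidableEq m]
    (M : Matrix m m ℂ) : List ℝ :=
  ((M.charpoly.roots).map (fun z => |Complex.arg z|)).sort (· ≥ ·)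

noncomputable def nu {n : ℕ} (μ : Fin n → ℝ) (M : Matrix (Fin n) (Fin n) ℂ) : ℝ :=
  ∑ j : Fin n, μ j * (absArgs M).getD j 0


section diagpart
open scoped Matrix.Norms.L2Operator

lemma unitary_diag {n : ℕ} (W : Matrix (Fin n) (Fin n) ℂ) (hW : W ∈ unitaryGroup (Fin n) ℂ) :
    ∃ Q ∈ unitaryGroup (Fin n) ℂ, ∃ d : Fin n → ℂ, (∀ j, ‖d j‖ = 1) ∧
      W = Q * diagonal d * star Q := by
  have hN : IsStarNormal W := ⟨by
    have h1 := (Unitary.mem_iff.1 hW).1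
    have h2 := (Unitary.mem_iff.1 hW).2
    rw [Commute, SemiconjBy, h1, h2]⟩
  have hfin : ∀ f : ℂ → ℂ, ContinuousOn f (spectrum ℂ W) := fun f =>
    (Matrix.finite_spectrum W).continuousOn f
  have hsp : ∀ z ∈ spectrum ℂ W, ‖z‖ = 1 := fun z hz => by
    have := spectrum.subset_circle_of_unitary hW hz
    simpa using this
  set B := cfc (fun z : ℂ => (arg z : ℂ)) W with hB
  have hsa : IsSelfAdjoint B := by
    rw [IsSelfAdjoint, hB, ← cfc_star]
    congr 1; ext z; simp
  have hBH : B.IsHermitian := hsa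
  have hWB : W = NormedSpace.exp (I • B) := by
    have hn : IsStarNormal (I • B) := by
      have := hsa.isStarNormal
      infer_instance
    rw [← CFC.complex_exp_eq_normedSpace_exp, ← cfc_comp_smul I _ B, hB,
      ← cfc_comp' (fun x : ℂ => exp (I • x)) (fun z : ℂ => (arg z : ℂ)) W
        (by fun_prop) (hfin _) hN]
    · conv_lhs => rw [← cfc_id' ℂ W]
      apply cfc_congr
      intro z hz
      have := Complex.norm_mul_exp_arg_mul_I z
      rw [hsp z hz] at this
      simp only [smul_eq_mul]
      rw [mul_comm I]
      simpa using this.symm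
  have hQ := hBH.eigenvectorUnitary.2
  refine ⟨hBH.eigenvectorUnitary, hQ, fun j => exp (I * hBH.eigenvalues j), ?_, ?_⟩
  · intro j
    simp only []
    rw [mul_comm, Complex.norm_exp_ofReal_mul_I]
  · have hinv : (hBH.eigenvectorUnitary : Matrix (Fin n) (Fin n) ℂ)⁻¹
        = star (hBH.eigenvectorUnitary : Matrix (Fin n) (Fin n) ℂ) :=
      Matrix.inv_eq_right_inv (Unitary.mem_iff.1 hQ).2
    conv_lhs => rw [hWB, hBH.spectral_theorem, Unitary.conjStarAlgAut_apply]
    rw [← smul_mul_assoc, ← mul_smul_comm, ← hinv, Matrix.exp_conj _ _ ?_,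
      ← Matrix.diagonal_smul, Matrix.exp_diagonal]
    · congr 3
      ext j
      simp [Complex.exp_eq_exp_ℂ, Pi.coe_exp]
    · exact ⟨⟨_, star _, (Unitary.mem_iff.1 hQ).2, (Unitary.mem_iff.1 hQ).1⟩, rfl⟩

end diagpart

lemma uconj_pow {n : ℕ} (S : Matrix (Fin n) (Fin n) ℂ) (hS : S ∈ unitaryGroup (Fin n) ℂ)
    (w : Fin n → ℂ) (k : ℕ) :
    (S * diagonal w * star S) ^ k = S * diagonal (fun j => w j ^ k) * star S := by
  induction k with
  | zero => simp [(Unitary.mem_iff.1 hS).2]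
  | succ k ih =>
    rw [pow_succ, ih]
    have : S * diagonal (fun j => w j ^ k) * star S * (S * diagonal w * star S)
      = S * diagonal (fun j => w j ^ k) * (star S * S) * diagonal w * star S := by noncomm_ring
    rw [this, (Unitary.mem_iff.1 hS).1, mul_one, mul_assoc S, diagonal_mul_diagonal]
    rfl

lemma roots_conj {n : ℕ} (S : Matrix (Fin n) (Fin n) ℂ) (hS : S ∈ unitaryGroup (Fin n) ℂ)
    (w : Fin n → ℂ) (f : ℂ → ℝ) :
    ((S * diagonal w * star S).charpoly.roots.map f).sum = ∑ j, f (w j) := by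
  rw [charpoly_mul_comm, ← mul_assoc, (Unitary.mem_iff.1 hS).1, one_mul, charpoly_diagonal,
    Polynomial.roots_prod _ _ (Finset.prod_ne_zero_iff.2 fun i _ => Polynomial.X_sub_C_ne_zero _)]
  simp [List.sum_ofFn]

lemma trace_conj {n : ℕ} (S : Matrix (Fin n) (Fin n) ℂ) (hS : S ∈ unitaryGroup (Fin n) ℂ)
    (w : Fin n → ℂ) :
    (S * diagonal w * star S).trace = ∑ j, w j := by
  rw [trace_mul_comm, ← mul_assoc, (Unitary.mem_iff.1 hS).1, one_mul, trace_diagonal]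

lemma diag_im_bound {n : ℕ} (T : Matrix (Fin n) (Fin n) ℂ) (hT : T ∈ unitaryGroup (Fin n) ℂ)
    (d : Fin n → ℂ) (C : ℝ) (hd : ∀ l, |(d l).im| ≤ C) (j : Fin n) :
    |((T * diagonal d * star T) j j).im| ≤ C := by
  have h1 : ∑ l, ‖T j l‖ ^ 2 = 1 := by
    have := congrFun (congrFun (Unitary.mem_iff.1 hT).2 j) j
    rw [mul_apply] at this
    simp only [star_apply, one_apply_eq, RCLike.star_def, Complex.mul_conj'] at this
    exact_mod_cast this
  have h2 : (T * diagonal d * star T) j j = ∑ l, ((‖T j l‖ ^ 2 : ℝ) : ℂ) * d l := by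
    rw [mul_apply]
    refine Finset.sum_congr rfl fun l _ => ?_
    rw [mul_diagonal, star_apply, RCLike.star_def, mul_right_comm, Complex.mul_conj']
    push_cast; rfl
  rw [h2, Complex.im_sum]
  simp only [Complex.im_ofReal_mul]
  calc _ ≤ ∑ l, |‖T j l‖ ^ 2 * (d l).im| := Finset.abs_sum_le_sum_abs _ _
    _ ≤ ∑ l, ‖T j l‖ ^ 2 * C := by
      refine Finset.sum_le_sum fun l _ => ?_
      rw [abs_mul, abs_of_nonneg (by positivity)]
      exact mul_le_mul_of_nonneg_left (hd l) (by positivity)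
    _ = C := by rw [← Finset.sum_mul, h1, one_mul]

lemma artanh_bound (z : ℂ) (hz : ‖z‖ < 1) :
    ∃ s : ℂ, HasSum (fun m : ℕ => z ^ (2 * m + 1) / ((2 * m + 1 : ℕ) : ℂ)) s ∧
      |s.im| ≤ Real.pi / 4 := by
  have h := (Complex.hasSum_arctan (z := -I * z) (by simpa using hz)).mul_left I
  refine ⟨I * (-I * z).arctan, ?_, ?_⟩
  · convert! h using 2 with m
    rw [mul_pow, pow_succ (-I), pow_mul, neg_sq, I_sq]
    have : ((-1 : ℂ) ^ m) * (-1) ^ m = 1 := by rw [← mul_pow]; simp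
    linear_combination (-(I * I) * (z ^ (2 * m + 1) / ((2 * m + 1 : ℕ) : ℂ))) * this.symm
      + (z ^ (2 * m + 1) / ((2 * m + 1 : ℕ) : ℂ)) * I_mul_I
  · have e : -I * z * I = z := by linear_combination (-z) * I_mul_I
    rw [Complex.arctan, e]
    have hne : (1 - z) ≠ 0 := by
      intro h0
      have : z = 1 := by linear_combination -h0
      rw [this] at hz; simp at hz
    have hre : 0 ≤ ((1 + z) / (1 - z)).re := by
      rw [Complex.div_re, ← add_div]
      apply div_nonneg _ (normSq_nonneg _)
      have : z.re ^ 2 + z.im ^ 2 < 1 := by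
        have h3 := Complex.sq_norm z
        rw [normSq_apply] at h3
        nlinarith [norm_nonneg z]
      simp
      nlinarith
    have := Complex.abs_arg_le_pi_div_two_iff.2 hre
    have e2 : (I * (-I / 2 * log ((1 + z) / (1 - z)))).im = ((1 + z) / (1 - z)).arg / 2 := by
      rw [show I * (-I / 2 * log ((1 + z) / (1 - z))) = ((1/2 : ℝ) : ℂ) * log ((1 + z) / (1 - z)) by
        push_cast; linear_combination (-1/2 * log ((1 + z) / (1 - z))) * I_mul_I]
      rw [Complex.im_ofReal_mul, Complex.log_im]; ring
    rw [e2, abs_div, abs_of_pos (by norm_num : (0:ℝ) < 2)]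
    linarith

lemma partial_bound (r : ℝ) (h0 : 0 ≤ r) (h1 : r < 1) (N : ℕ) (z : ℂ) (hz : ‖z‖ = 1) :
    |(∑ m ∈ Finset.range N, (r : ℂ) ^ (2 * m + 1) * z ^ (2 * m + 1) / ((2 * m + 1 : ℕ) : ℂ)).im|
      ≤ Real.pi / 4 + ∑' m : ℕ, r ^ (m + N) := by
  have hn : ‖(r : ℂ) * z‖ = r := by simp [hz, abs_of_nonneg h0]
  obtain ⟨s, hs, hb⟩ := artanh_bound (r * z) (by rw [hn]; exact h1)
  simp only [mul_pow] at hs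
  set f := fun m : ℕ => (r : ℂ) ^ (2 * m + 1) * z ^ (2 * m + 1) / ((2 * m + 1 : ℕ) : ℂ) with hf
  have hsplit := hs.summable.sum_add_tsum_nat_add N
  rw [hs.tsum_eq] at hsplit
  have hfb : ∀ m, ‖f m‖ ≤ r ^ m := by
    intro m
    simp only [hf]
    rw [norm_div, norm_mul, norm_pow, norm_pow, hz, one_pow, mul_one, Complex.norm_natCast,
      Complex.norm_real, Real.norm_of_nonneg h0]
    calc r ^ (2 * m + 1) / ((2 * m + 1 : ℕ) : ℝ) ≤ r ^ (2 * m + 1) :=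
          div_le_self (by positivity) (by norm_cast; omega)
      _ ≤ r ^ m := pow_le_pow_of_le_one h0 h1.le (by omega)
  have hsum : Summable fun m => r ^ (m + N) :=
    (summable_nat_add_iff N).2 (summable_geometric_of_lt_one h0 h1)
  have htail : ‖∑' m, f (m + N)‖ ≤ ∑' m : ℕ, r ^ (m + N) :=
    tsum_of_norm_bounded hsum.hasSum (fun m => hfb _)
  have him := Complex.abs_im_le_norm (∑' m, f (m + N))
  have : (∑ m ∈ Finset.range N, f m).im = s.im - (∑' m, f (m + N)).im := by
    rw [← hsplit]; simp
  rw [this]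
  refine (abs_sub _ _).trans ?_
  linarith

lemma cos_all (θ : ℝ) (h0 : 0 ≤ θ) (h1 : θ ≤ 2 * Real.pi) :
    HasSum (fun n : ℕ => 1 / (n : ℝ) ^ 2 * Real.cos (n * θ))
      (Real.pi ^ 2 / 6 - Real.pi * θ / 2 + θ ^ 2 / 4) := by
  have hpi := Real.pi_pos
  have h := hasSum_one_div_nat_pow_mul_cos (k := 1) one_ne_zero (x := θ / (2 * Real.pi))
    ⟨by positivity, by rw [div_le_one (by positivity)]; exact h1⟩
  convert h using 1
  · ext n
    congr 2
    field_simp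
  · have hb : (Polynomial.bernoulli 2) = Polynomial.X ^ 2 - Polynomial.X + Polynomial.C (1/6 : ℚ) := by
      rw [Polynomial.bernoulli_def]
      simp [Finset.sum_range_succ, _root_.bernoulli, bernoulli'_two, bernoulli'_one,
        ← Polynomial.C_mul_X_pow_eq_monomial]
      have : (Polynomial.C (2⁻¹ : ℚ)) * 2 = 1 := by
        rw [← Polynomial.C_ofNat, ← Polynomial.C_mul]; norm_num
      linear_combination (-Polynomial.X) * this
    rw [show 2 * 1 = 2 from rfl, hb]
    simp
    field_simp
    ring

lemma cos_odd (θ : ℝ) (h1 : |θ| ≤ Real.pi) :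
    HasSum (fun m : ℕ => Real.cos ((2 * m + 1 : ℕ) * θ) / ((2 * m + 1 : ℕ) : ℝ) ^ 2)
      (Real.pi ^ 2 / 8 - Real.pi * |θ| / 4) := by
  have key : ∀ θ : ℝ, 0 ≤ θ → θ ≤ Real.pi →
    HasSum (fun m : ℕ => Real.cos ((2 * m + 1 : ℕ) * θ) / ((2 * m + 1 : ℕ) : ℝ) ^ 2)
      (Real.pi ^ 2 / 8 - Real.pi * θ / 4) := by
    intro θ h0 h1
    have hA := cos_all θ h0 (by linarith [Real.pi_pos])
    have hE := (cos_all (2 * θ) (by linarith) (by linarith)).mul_left (1/4)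
    set f := fun n : ℕ => 1 / (n : ℝ) ^ 2 * Real.cos (n * θ) with hf
    have hE' : HasSum (fun m => f (2 * m)) (1 / 4 * (Real.pi ^ 2 / 6 - Real.pi * (2 * θ) / 2 + (2 * θ) ^ 2 / 4)) := by
      convert! hE using 2 with m
      simp only [hf]
      push_cast
      rw [show (2 * (m : ℝ)) * θ = m * (2 * θ) by ring]
      ring
    have hO : Summable fun m => f (2 * m + 1) :=
      hA.summable.comp_injective (i := fun m => 2 * m + 1) (fun a b h => by simpa using h)
    have := hE'.even_add_odd hO.hasSum
    have hu := this.unique hA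
    have hO2 := hO.hasSum
    rw [show (∑' m, f (2 * m + 1)) = Real.pi ^ 2 / 8 - Real.pi * θ / 4 by linarith] at hO2
    convert hO2 using 2 with m
    simp only [hf]; ring
  rcases abs_cases θ with ⟨h, h'⟩ | ⟨h, h'⟩
  · rw [h] at h1 ⊢; exact key θ h' h1
  · rw [h] at h1 ⊢
    convert key (-θ) (by linarith) h1 using 3 with m
    rw [mul_neg, Real.cos_neg]

section mainpart
open scoped Matrix.Norms.L2Operator

lemma exp_form {n : ℕ} (Q : Matrix (Fin n) (Fin n) ℂ) (hQ : Q ∈ unitaryGroup (Fin n) ℂ)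
    (d : Fin n → ℂ) :
    NormedSpace.exp (Q * diagonal d * star Q) = Q * diagonal (fun j => exp (d j)) * star Q := by
  have hinv : Q⁻¹ = star Q := Matrix.inv_eq_right_inv (Unitary.mem_iff.1 hQ).2
  rw [← hinv, Matrix.exp_conj _ _ ?_, Matrix.exp_diagonal]
  · congr 3
    ext j
    simp [Complex.exp_eq_exp_ℂ, Pi.coe_exp]
  · exact ⟨⟨_, star _, (Unitary.mem_iff.1 hQ).2, (Unitary.mem_iff.1 hQ).1⟩, rfl⟩

lemma form_unitary {n : ℕ} (Q : Matrix (Fin n) (Fin n) ℂ) (hQ : Q ∈ unitaryGroup (Fin n) ℂ)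
    (d : Fin n → ℂ) (hd : ∀ j, ‖d j‖ = 1) :
    Q * diagonal d * star Q ∈ unitaryGroup (Fin n) ℂ := by
  refine mul_mem (mul_mem hQ ?_) (Unitary.star_mem hQ)
  rw [mem_unitaryGroup_iff, star_eq_conjTranspose, diagonal_conjTranspose, diagonal_mul_diagonal,
    ← diagonal_one]
  congr 1
  ext j
  simp [Complex.mul_conj', hd]

lemma trace_pow_deriv {n : ℕ} (U A : Matrix (Fin n) (Fin n) ℂ) (k : ℕ) (t : ℝ) :
    HasDerivAt (fun t : ℝ => ((U * NormedSpace.exp (t • A)) ^ (k + 1)).trace)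
      (((k + 1 : ℕ) : ℂ) * ((U * NormedSpace.exp (t • A)) ^ (k + 1) * A).trace) t := by
  have h1 : HasDerivAt (fun t : ℝ => U * NormedSpace.exp (t • A))
      (U * (NormedSpace.exp (t • A) * A)) t :=
    (hasDerivAt_exp_smul_const A t).const_mul U
  have h2 := h1.fun_pow' (k + 1)
  have h3 := ((Matrix.traceLinearMap (Fin n) ℝ ℂ).toContinuousLinearMap.hasFDerivAt).comp_hasDerivAt
    t h2
  convert! h3 using 1
  simp only [LinearMap.coe_toContinuousLinearMap', Matrix.traceLinearMap_apply, Matrix.trace_sum]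
  rw [Finset.sum_congr rfl (g := fun _ => ((U * NormedSpace.exp (t • A)) ^ (k + 1) * A).trace)]
  · simp
  · intro i hi
    have hi' : i ≤ k := by simpa [Nat.lt_succ_iff] using hi
    rw [trace_mul_comm, ← mul_assoc, ← pow_add, ← mul_assoc U, ← mul_assoc, ← pow_succ]
    congr 3
    simp; omega

lemma key_ineq {n : ℕ} (U Q : Matrix (Fin n) (Fin n) ℂ) (hU : U ∈ unitaryGroup (Fin n) ℂ)
    (hQ : Q ∈ unitaryGroup (Fin n) ℂ) (b : Fin n → ℝ) (c : ℕ → ℝ) (N : ℕ) (C : ℝ)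
    (hC : ∀ z : ℂ, ‖z‖ = 1 →
      |(∑ m ∈ Finset.range N, ((c m : ℂ) * ((2 * m + 1 : ℕ) : ℂ)) * z ^ (2 * m + 1)).im| ≤ C) :
    |(∑ m ∈ Finset.range N, (c m : ℂ) *
        ((U * (Q * diagonal (fun j => exp (I * b j)) * star Q)) ^ (2 * m + 1)).trace).re
      - (∑ m ∈ Finset.range N, (c m : ℂ) * (U ^ (2 * m + 1)).trace).re|
      ≤ C * ∑ j, |b j| := by
  set A := Q * diagonal (fun j => I * (b j : ℂ)) * star Q with hA
  set W : ℝ → Matrix (Fin n) (Fin n) ℂ := fun t => U * NormedSpace.exp (t • A) with hW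
  have hWt : ∀ t, W t = U * (Q * diagonal (fun j => exp (I * ((t * b j : ℝ) : ℂ))) * star Q) := by
    intro t
    simp only [hW]
    rw [← exp_form Q hQ, hA, ← smul_mul_assoc, ← mul_smul_comm, ← diagonal_smul]
    congr 5
    ext j
    simp; ring
  have hWu : ∀ t, W t ∈ unitaryGroup (Fin n) ℂ := by
    intro t
    rw [hWt]
    refine mul_mem hU (form_unitary Q hQ _ fun j => ?_)
    rw [mul_comm, Complex.norm_exp_ofReal_mul_I]
  have hW0 : W 0 = U := by simp [hW]
  have hW1 : W 1 = U * (Q * diagonal (fun j => exp (I * b j)) * star Q) := by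
    rw [hWt]; simp
  rw [← hW1]
  conv_lhs => rw [← hW0]
  have hd : ∀ t, HasDerivAt (fun t : ℝ =>
      (∑ m ∈ Finset.range N, (c m : ℂ) * ((W t) ^ (2 * m + 1)).trace).re)
      (∑ m ∈ Finset.range N, (c m : ℂ) *
        (((2 * m + 1 : ℕ) : ℂ) * ((W t) ^ (2 * m + 1) * A).trace)).re t := by
    intro t
    have h := HasDerivAt.fun_sum (u := Finset.range N) fun m _ =>
      (trace_pow_deriv U A (2 * m) t).const_mul (c m : ℂ)
    exact (Complex.reCLM.hasFDerivAt).comp_hasDerivAt t h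
  have := norm_image_sub_le_of_norm_deriv_le_segment_01'
    (fun t _ => (hd t).hasDerivWithinAt) (C := C * ∑ j, |b j|) ?_
  · simpa only [Real.norm_eq_abs, hW0] using this
  intro t _
  obtain ⟨S, hS, w, hw, hdec⟩ := unitary_diag (W t) (hWu t)
  set h : ℂ → ℂ := fun z =>
    ∑ m ∈ Finset.range N, ((c m : ℂ) * ((2 * m + 1 : ℕ) : ℂ)) * z ^ (2 * m + 1) with hh
  have e1 : ∑ m ∈ Finset.range N, (c m : ℂ) *
        (((2 * m + 1 : ℕ) : ℂ) * ((W t) ^ (2 * m + 1) * A).trace)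
      = ((S * diagonal (fun l => h (w l)) * star S) * A).trace := by
    have : diagonal (fun l => h (w l)) = ∑ m ∈ Finset.range N,
        ((c m : ℂ) * ((2 * m + 1 : ℕ) : ℂ)) • diagonal (fun l => w l ^ (2 * m + 1)) := by
      ext i j
      rw [Matrix.sum_apply]
      by_cases hij : i = j
      · subst hij; simp [hh]
      · simp [hij]
    rw [this, Finset.mul_sum, Finset.sum_mul, Finset.sum_mul, Matrix.trace_sum]
    refine Finset.sum_congr rfl fun m _ => ?_
    rw [hdec, uconj_pow S hS, mul_smul_comm, smul_mul_assoc, smul_mul_assoc, trace_smul, smul_eq_mul,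
      mul_assoc (c m : ℂ)]
  set T := star Q * S with hT
  have hTu : T ∈ unitaryGroup (Fin n) ℂ := mul_mem (Unitary.star_mem hQ) hS
  have e2 : ((S * diagonal (fun l => h (w l)) * star S) * A).trace
      = ∑ j, (T * diagonal (fun l => h (w l)) * star T) j j * (I * b j) := by
    have : (S * diagonal (fun l => h (w l)) * star S) * A
      = ((S * diagonal (fun l => h (w l)) * star S) * Q * diagonal (fun j => I * (b j : ℂ)))
        * star Q := by
      rw [hA]; simp only [mul_assoc]
    rw [this, trace_mul_comm, hT, star_mul, star_star]
    rw [show star Q * (S * diagonal (fun l => h (w l)) * star S * Q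
        * diagonal (fun j => I * (b j : ℂ))) = (star Q * S * diagonal (fun l => h (w l)) *
        (star S * Q)) * diagonal (fun j => I * (b j : ℂ)) by simp only [mul_assoc]]
    simp only [trace, diag_apply, mul_diagonal]
  rw [e1, e2, Complex.re_sum, Real.norm_eq_abs, Finset.mul_sum]
  refine (Finset.abs_sum_le_sum_abs _ _).trans (Finset.sum_le_sum fun j _ => ?_)
  have hb := diag_im_bound T hTu (fun l => h (w l)) C (fun l => hC _ (hw l)) j
  have e3 : ((T * diagonal (fun l => h (w l)) * star T) j j * (I * b j)).re
      = -((T * diagonal (fun l => h (w l)) * star T) j j).im * b j := by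
    simp [Complex.mul_re, Complex.mul_im]
  rw [e3, abs_mul, abs_neg]
  exact mul_le_mul_of_nonneg_right hb (abs_nonneg _)

end mainpart

open Filter Topology in
lemma limit_r (r : ℝ) (h0 : 0 ≤ r) (h1 : r < 1) {n : ℕ} (x y : Fin n → ℂ)
    (hx : ∀ j, ‖x j‖ = 1) (hy : ∀ j, ‖y j‖ = 1) (B : ℝ)
    (H : ∀ (c : ℕ → ℝ) (N : ℕ) (C : ℝ), (∀ z : ℂ, ‖z‖ = 1 →
      |(∑ m ∈ Finset.range N, ((c m : ℂ) * ((2 * m + 1 : ℕ) : ℂ)) * z ^ (2 * m + 1)).im| ≤ C) →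
      (∑ m ∈ Finset.range N, c m * ∑ j, (y j ^ (2 * m + 1)).re)
        - (∑ m ∈ Finset.range N, c m * ∑ j, (x j ^ (2 * m + 1)).re) ≤ C * B) :
    (∑' m : ℕ, r ^ (2 * m + 1) / ((2 * m + 1 : ℕ) : ℝ) ^ 2 * ∑ j, (y j ^ (2 * m + 1)).re)
      - (∑' m : ℕ, r ^ (2 * m + 1) / ((2 * m + 1 : ℕ) : ℝ) ^ 2 * ∑ j, (x j ^ (2 * m + 1)).re)
      ≤ Real.pi / 4 * B := by
  have hs : ∀ u : Fin n → ℂ, (∀ j, ‖u j‖ = 1) → Summable fun m : ℕ =>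
      r ^ (2 * m + 1) / ((2 * m + 1 : ℕ) : ℝ) ^ 2 * ∑ j, (u j ^ (2 * m + 1)).re := by
    intro u hu
    refine Summable.of_norm_bounded (g := fun m => r ^ m * n)
      ((summable_geometric_of_lt_one h0 h1).mul_right _) fun m => ?_
    rw [norm_mul]
    refine mul_le_mul ?_ ?_ (norm_nonneg _) (by positivity)
    · rw [Real.norm_of_nonneg (by positivity)]
      calc r ^ (2 * m + 1) / ((2 * m + 1 : ℕ) : ℝ) ^ 2 ≤ r ^ (2 * m + 1) :=
          div_le_self (by positivity) (one_le_pow₀ (by norm_cast; omega))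
        _ ≤ r ^ m := pow_le_pow_of_le_one h0 h1.le (by omega)
    · refine (norm_sum_le _ _).trans ((Finset.sum_le_sum (g := fun _ => (1:ℝ)) fun j _ => ?_).trans ?_)
      · refine (Complex.abs_re_le_norm _).trans ?_
        rw [norm_pow, hu, one_pow]
      · simp
  have t1 := ((hs y hy).hasSum.tendsto_sum_nat).sub ((hs x hx).hasSum.tendsto_sum_nat)
  have t2 : Tendsto (fun N : ℕ => (Real.pi / 4 + ∑' m : ℕ, r ^ (m + N)) * B) atTop
      (𝓝 ((Real.pi / 4 + 0) * B)) :=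
    (tendsto_const_nhds.add (tendsto_sum_nat_add fun m => r ^ m)).mul_const B
  rw [add_zero] at t2
  refine le_of_tendsto_of_tendsto' t1 t2 fun N => ?_
  refine H (fun m => r ^ (2 * m + 1) / ((2 * m + 1 : ℕ) : ℝ) ^ 2) N _ fun z hz => ?_
  refine Eq.trans_le ?_ (partial_bound r h0 h1 N z hz)
  congr 2
  refine Finset.sum_congr rfl fun m _ => ?_
  have : ((2 * m + 1 : ℕ) : ℂ) ≠ 0 := by norm_cast
  push_cast at this ⊢
  field_simp

open Filter Topology in
lemma tsum_limit {n : ℕ} (u : Fin n → ℂ) (hu : ∀ j, ‖u j‖ = 1) :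
    Tendsto (fun r : ℝ => ∑' m : ℕ, r ^ (2 * m + 1) / ((2 * m + 1 : ℕ) : ℝ) ^ 2 *
      ∑ j, (u j ^ (2 * m + 1)).re) (𝓝[<] 1)
      (𝓝 (∑ j, (Real.pi ^ 2 / 8 - Real.pi * |arg (u j)| / 4))) := by
  have hre : ∀ j (k : ℕ), (u j ^ k).re = Real.cos (k * arg (u j)) := by
    intro j k
    have h := Complex.norm_mul_exp_arg_mul_I (u j)
    rw [hu, ofReal_one, one_mul] at h
    conv_lhs => rw [← h, ← Complex.exp_nat_mul, ← mul_assoc]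
    rw [show (k : ℂ) * (arg (u j) : ℂ) = ((k * arg (u j) : ℝ) : ℂ) by push_cast; rfl,
      Complex.exp_ofReal_mul_I_re]
  have hS : HasSum (fun m : ℕ => (1 : ℝ) ^ (2 * m + 1) / ((2 * m + 1 : ℕ) : ℝ) ^ 2 *
      ∑ j, (u j ^ (2 * m + 1)).re) (∑ j, (Real.pi ^ 2 / 8 - Real.pi * |arg (u j)| / 4)) := by
    have := hasSum_sum (s := Finset.univ) fun j (_ : j ∈ Finset.univ) =>
      cos_odd (arg (u j)) (Complex.abs_arg_le_pi (u j))
    convert! this using 2 with m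
    rw [Finset.mul_sum]
    refine Finset.sum_congr rfl fun j _ => ?_
    rw [hre]; ring
  rw [← hS.tsum_eq]
  have hb : Summable fun m : ℕ => 1 / ((2 * m + 1 : ℕ) : ℝ) ^ 2 * (n : ℝ) := by
    refine Summable.mul_right _ ?_
    exact (Real.summable_one_div_nat_pow.2 one_lt_two).comp_injective (i := fun m : ℕ => 2 * m + 1)
      (fun a b h => by simpa using h)
  refine tendsto_tsum_of_dominated_convergence hb (fun m => ?_) ?_
  · refine Tendsto.mono_left (Continuous.tendsto ?_ 1) nhdsWithin_le_nhds
    fun_prop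
  · have : ∀ᶠ r : ℝ in 𝓝[<] 1, r ∈ Set.Ioo (0:ℝ) 1 := Ioo_mem_nhdsLT one_pos
    filter_upwards [this] with r hr m
    rw [norm_mul]
    have := hr.1
    refine mul_le_mul ?_ ?_ (norm_nonneg _) (by positivity)
    · rw [Real.norm_of_nonneg (by positivity)]
      gcongr
      exact pow_le_one₀ hr.1.le hr.2.le
    · refine (norm_sum_le _ _).trans ((Finset.sum_le_sum (g := fun _ => (1:ℝ)) fun j _ => ?_).trans ?_)
      · refine (Complex.abs_re_le_norm _).trans ?_
        rw [norm_pow, hu, one_pow]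
      · simp

open Filter Topology in
theorem stmt2 {n : ℕ} (U V : Matrix (Fin n) (Fin n) ℂ)
    (hU : U ∈ Matrix.unitaryGroup (Fin n) ℂ) (hV : V ∈ Matrix.unitaryGroup (Fin n) ℂ) :
    ((U * V).charpoly.roots.map (fun z => |Complex.arg z|)).sum
      ≤ (U.charpoly.roots.map (fun z => |Complex.arg z|)).sum
        + (V.charpoly.roots.map (fun z => |Complex.arg z|)).sum := by
  obtain ⟨P, hP, x, hx, hUd⟩ := unitary_diag U hU
  obtain ⟨Q, hQ, v, hv, hVd⟩ := unitary_diag V hV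
  obtain ⟨R, hR, y, hy, hUVd⟩ := unitary_diag (U * V) (mul_mem hU hV)
  have hvexp : v = fun j => exp (I * (arg (v j) : ℂ)) := by
    ext j
    have h := Complex.norm_mul_exp_arg_mul_I (v j)
    rw [hv, ofReal_one, one_mul] at h
    rw [mul_comm, h]
  have hfin : ∀ r : ℝ, 0 ≤ r → r < 1 → _ := fun r h0 h1 =>
    limit_r r h0 h1 y x hy hx (∑ j, |arg (v j)|) (by
      intro c N C hC
      have h := key_ineq U Q hU hQ (fun j => arg (v j)) c N C hC
      rw [← hvexp, ← hVd, hUVd] at h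
      rw [hUd] at h
      simp only [uconj_pow R hR, uconj_pow P hP, trace_conj R hR, trace_conj P hP, Complex.re_sum,
        Complex.re_ofReal_mul] at h
      have := (abs_le.1 h).1
      linarith)
  have hlim := le_of_tendsto ((tsum_limit x hx).sub (tsum_limit y hy))
    (by
      have : ∀ᶠ r : ℝ in 𝓝[<] 1, r ∈ Set.Ioo (0:ℝ) 1 := Ioo_mem_nhdsLT one_pos
      filter_upwards [this] with r hr
      exact hfin r hr.1.le hr.2)
  rw [hUVd, roots_conj R hR, hUd, roots_conj P hP, hVd, roots_conj Q hQ]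
  simp only [Finset.sum_sub_distrib, ← Finset.sum_div, ← Finset.mul_sum] at hlim
  have hpi := Real.pi_pos
  have : Real.pi * (∑ j, |arg (y j)|) ≤ Real.pi * ((∑ j, |arg (x j)|) + ∑ j, |arg (v j)|) := by
    linarith
  exact le_of_mul_le_mul_left this hpi
end

section
/- Let U, V be n×n unitary matrices and let μ_1 ≥ μ_2 ≥ ... ≥ μ_n ≥ 0. Denote by θ_j^↓(W) the absolute values of the principal arguments of the eigenvalues of a unitary W arranged in descending order. Then Σ_j μ_j θ_j^↓(UV) ≤ Σ_j μ_j θ_j^↓(U) + Σ_j μ_j θ_j^↓(V). -/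
open Complex Matrix

def UD {n : ℕ} (U Q : Matrix (Fin n) (Fin n) ℂ) (φ : Fin n → ℝ) : Prop :=
  Q ∈ Matrix.unitaryGroup (Fin n) ℂ ∧ U = Q * diagonal (fun j => Complex.exp (φ j * I)) * star Q

lemma exists_UD {n : ℕ} (U : Matrix (Fin n) (Fin n) ℂ) (hU : U ∈ Matrix.unitaryGroup (Fin n) ℂ) :
    ∃ Q φ, UD U Q φ ∧ ∀ j, -Real.pi < φ j ∧ φ j ≤ Real.pi := by
  obtain ⟨c, hc1, hc⟩ : ∃ c : ℂ, ‖c‖ = 1 ∧ U.charpoly.eval c ≠ 0 := by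
    have h1 : (Metric.sphere (0:ℂ) 1).Infinite := by
      intro hfin
      have hinj : Function.Injective (fun k : ℕ => (Complex.exp ((k:ℝ) * I))) := by
        intro a b hab
        simp only at hab
        rw [Complex.exp_eq_exp_iff_exists_int] at hab
        obtain ⟨m, hm⟩ := hab
        have h2 : ((a:ℝ):ℂ) = ((b + m * (2 * Real.pi) : ℝ) : ℂ) := by
          have : (((a:ℝ):ℂ) - ((b + m * (2 * Real.pi) : ℝ) : ℂ)) * I = 0 := by
            push_cast
            push_cast at hm
            linear_combination hm
          rcases mul_eq_zero.mp this with h | h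
          · linear_combination h
          · exact absurd h I_ne_zero
        have h3 : (a:ℝ) = b + m * (2 * Real.pi) := by exact_mod_cast h2
        by_cases hm0 : m = 0
        · subst hm0; simpa using h3
        · exfalso
          have hir := irrational_pi
          apply hir
          refine ⟨((a:ℚ) - b) / (2 * m), ?_⟩
          have : (m:ℝ) ≠ 0 := by exact_mod_cast hm0
          push_cast
          field_simp
          linarith
      have := Set.infinite_range_of_injective hinj
      apply this
      apply hfin.subset
      rintro _ ⟨k, rfl⟩
      simp only [mem_sphere_iff_norm, sub_zero]
      exact Complex.norm_exp_ofReal_mul_I _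
    have h2 : ({z | z ∈ U.charpoly.roots.toFinset} : Set ℂ).Finite := Finset.finite_toSet _
    obtain ⟨c, hc, hc'⟩ := (h1.sdiff h2).nonempty
    refine ⟨c, by simpa using hc, ?_⟩
    intro h
    apply hc'
    simp only [Set.mem_ofPred_eq, Multiset.mem_toFinset]
    exact (Polynomial.mem_roots (U.charpoly_monic.ne_zero)).2 h
  have hUU : star U * U = 1 := (Matrix.mem_unitaryGroup_iff'.1 hU)
  have hUU' : U * star U = 1 := (Matrix.mem_unitaryGroup_iff.1 hU)
  set A : Matrix (Fin n) (Fin n) ℂ := Matrix.scalar (Fin n) c - U with hA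
  have hAdet : IsUnit A.det := by
    rw [isUnit_iff_ne_zero]
    rw [Matrix.eval_charpoly] at hc
    exact hc
  have hcc : star c * c = 1 := by
    rw [Complex.star_def, ← Complex.normSq_eq_conj_mul_self, Complex.normSq_eq_norm_sq, hc1]; simp
  have hA' : A = c • 1 - U := by
    rw [hA]; congr 1; ext i j; simp [Matrix.scalar_apply, Matrix.one_apply, Matrix.diagonal_apply]
  set H : Matrix (Fin n) (Fin n) ℂ := I • (A⁻¹ * (c • 1 + U)) with hH
  have hAA : A * A⁻¹ = 1 := Matrix.mul_nonsing_inv _ hAdet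
  have hAA' : A⁻¹ * A = 1 := Matrix.nonsing_inv_mul _ hAdet
  have hAH : A * H = I • (c • 1 + U) := by
    rw [hH, Matrix.mul_smul, ← mul_assoc, hAA, one_mul]
  -- A* H A is Hermitian
  have hHerm : H.IsHermitian := by
    have hHA : H * A = I • (c • 1 + U) := by
      rw [hH, Matrix.smul_mul]
      congr 1
      have : (c • 1 + U) * A = A * (c • 1 + U) := by
        rw [hA']; simp only [mul_sub, sub_mul, mul_add, add_mul, smul_mul_assoc, mul_smul_comm, one_mul, mul_one, smul_add, smul_sub]
        abel
      rw [mul_assoc, this, ← mul_assoc, hAA', one_mul]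
    have key : star A * H * A = star A * star H * A := by
      have e1 : star A * star H = (-I) • (star c • 1 + star U) := by
        rw [← star_mul, hHA]; simp
      have e2 : star A = star c • 1 - star U := by rw [hA']; simp
      rw [mul_assoc, hHA, e1, e2, hA']
      simp only [mul_sub, sub_mul, mul_add, add_mul, smul_mul_assoc, mul_smul_comm, one_mul, mul_one, smul_add, smul_sub, hUU, smul_smul]
      have i1 : I * c * star c = I := by linear_combination I * hcc
      have i2 : c * (-I * star c) = -I := by linear_combination -I * hcc
      rw [i1, i2]
      module
    have hs1 : star A⁻¹ * star A = 1 := by rw [← star_mul, hAA]; simp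
    have : star H = H := by
      have h := congrArg (fun X => star A⁻¹ * X * A⁻¹) key
      simp only [mul_assoc, hAA, mul_one] at h
      simp only [← mul_assoc, hs1, one_mul] at h
      exact h.symm
    exact this
  set Q : Matrix (Fin n) (Fin n) ℂ := (hHerm.eigenvectorUnitary : Matrix (Fin n) (Fin n) ℂ) with hQ
  have hQm : Q ∈ Matrix.unitaryGroup (Fin n) ℂ := hHerm.eigenvectorUnitary.2
  have hQQ : Q * star Q = 1 := (Matrix.mem_unitaryGroup_iff.1 hQm)
  have hQQ' : star Q * Q = 1 := (Matrix.mem_unitaryGroup_iff'.1 hQm)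
  set d := hHerm.eigenvalues
  have hHQ : H * Q = Q * diagonal (fun j => (d j : ℂ)) := by
    have := hHerm.spectral_theorem
    rw [Unitary.conjStarAlgAut_apply] at this
    conv_lhs => rw [this]
    rw [mul_assoc, hQQ', mul_one]
    rfl
  have hne : ∀ j, (d j : ℂ) + I ≠ 0 := by
    intro j h
    have := congrArg Complex.im h
    simp at this
  set e : Fin n → ℂ := fun j => c * ((d j - I) / (d j + I)) with he
  have hUQ : U * Q = Q * diagonal e := by
    have h : A * (H * Q) = A * (Q * diagonal (fun j => (d j : ℂ))) := by rw [hHQ]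
    rw [← mul_assoc, hAH, hA', sub_mul, smul_mul_assoc, smul_mul_assoc, one_mul, add_mul, smul_mul_assoc, one_mul, ← mul_assoc] at h
    ext i j
    have hij := congrFun (congrFun h i) j
    simp only [Matrix.add_apply, Matrix.sub_apply, Matrix.smul_apply, Matrix.mul_diagonal, smul_eq_mul] at hij
    simp only [Matrix.mul_diagonal, he]
    have := hne j
    field_simp
    linear_combination hij
  have hnorm : ∀ j, ‖e j‖ = 1 := by
    intro j
    simp only [he]
    rw [norm_mul, hc1, norm_div, one_mul]
    have : ‖(d j : ℂ) - I‖ = ‖(d j : ℂ) + I‖ := by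
      rw [← Complex.norm_conj]; simp
    rw [this, div_self]
    exact norm_ne_zero_iff.2 (hne j)
  refine ⟨Q, fun j => Complex.arg (e j), ⟨hQm, ?_⟩, fun j => ⟨Complex.neg_pi_lt_arg _, Complex.arg_le_pi _⟩⟩
  have : (fun j => Complex.exp ((Complex.arg (e j) : ℝ) * I)) = e := by
    funext j
    have := Complex.norm_mul_exp_arg_mul_I (e j)
    rw [hnorm] at this
    simpa using this
  rw [this, ← hUQ, mul_assoc, hQQ, mul_one]

lemma UD.roots {n : ℕ} {U Q : Matrix (Fin n) (Fin n) ℂ} {φ : Fin n → ℝ} (h : UD U Q φ) :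
    U.charpoly.roots = Finset.univ.val.map (fun j => Complex.exp (φ j * I)) := by
  have hQQ' : star Q * Q = 1 := (Matrix.mem_unitaryGroup_iff'.1 h.1)
  rw [h.2, Matrix.charpoly_mul_comm, ← mul_assoc, hQQ', one_mul, Matrix.charpoly_diagonal]
  have := Polynomial.roots_multiset_prod_X_sub_C
    (Finset.univ.val.map (fun j => Complex.exp (φ j * I)))
  rw [Multiset.map_map] at this
  exact this

lemma UD.det {n : ℕ} {U Q : Matrix (Fin n) (Fin n) ℂ} {φ : Fin n → ℝ} (h : UD U Q φ) :
    U.det = Complex.exp ((∑ j, φ j : ℝ) * I) := by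
  have hQQ' : star Q * Q = 1 := (Matrix.mem_unitaryGroup_iff'.1 h.1)
  rw [h.2, Matrix.det_mul_comm, ← mul_assoc, hQQ', one_mul, Matrix.det_diagonal, ← Complex.exp_sum]
  push_cast
  rw [Finset.sum_mul]

lemma UD.mem {n : ℕ} {U Q : Matrix (Fin n) (Fin n) ℂ} {φ : Fin n → ℝ} (h : UD U Q φ) :
    U ∈ Matrix.unitaryGroup (Fin n) ℂ := by
  have hQ := h.1
  rw [h.2]
  refine mul_mem (mul_mem hQ ?_) (Unitary.star_mem hQ)
  rw [Matrix.mem_unitaryGroup_iff, Matrix.star_eq_conjTranspose, Matrix.diagonal_conjTranspose, Matrix.diagonal_mul_diagonal]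
  ext i j
  by_cases hij : i = j
  · subst hij
    simp [← Complex.exp_conj, ← Complex.exp_add]
  · simp [hij]

/-- quadratic form -/
lemma UD.qf {n : ℕ} {U Q : Matrix (Fin n) (Fin n) ℂ} {φ : Fin n → ℝ} (h : UD U Q φ)
    (x : Fin n → ℂ) (m : ℝ) :
    (Complex.exp (-(m:ℂ) * I) * (star x ⬝ᵥ (U *ᵥ x))).re =
      ∑ j, Real.cos (φ j - m) * ‖(star Q *ᵥ x) j‖ ^ 2 := by
  have : star x ⬝ᵥ (U *ᵥ x) =
      ∑ j, Complex.exp (φ j * I) * ((‖(star Q *ᵥ x) j‖ ^ 2 : ℝ) : ℂ) := by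
    rw [h.2, ← Matrix.mulVec_mulVec, ← Matrix.mulVec_mulVec, Matrix.dotProduct_mulVec]
    have e : star x ᵥ* Q = star (star Q *ᵥ x) := by
      rw [Matrix.star_mulVec]; simp [Matrix.star_eq_conjTranspose]
    rw [e]
    simp only [dotProduct, Matrix.mulVec_diagonal, Pi.star_apply]
    refine Finset.sum_congr rfl fun j _ => ?_
    rw [Complex.ofReal_pow, ← Complex.conj_mul', Complex.star_def]
    ring
  rw [this, Finset.mul_sum, Complex.re_sum]
  refine Finset.sum_congr rfl fun j _ => ?_
  rw [← mul_assoc, ← Complex.exp_add, Complex.re_mul_ofReal]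
  congr 1
  have : (-(m:ℂ) * I + φ j * I) = ((φ j - m : ℝ) : ℂ) * I := by push_cast; ring
  rw [this, Complex.exp_ofReal_mul_I_re]

lemma norm_sum {n : ℕ} {Q : Matrix (Fin n) (Fin n) ℂ} (hQ : Q ∈ Matrix.unitaryGroup (Fin n) ℂ)
    (x : Fin n → ℂ) : ∑ j, ‖(star Q *ᵥ x) j‖ ^ 2 = ∑ j, ‖x j‖ ^ 2 := by
  have hQQ : Q * star Q = 1 := (Matrix.mem_unitaryGroup_iff.1 hQ)
  have h : ∀ y : Fin n → ℂ, star y ⬝ᵥ y = ((∑ j, ‖y j‖ ^ 2 : ℝ) : ℂ) := by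
    intro y
    simp only [dotProduct, Pi.star_apply]
    push_cast
    refine Finset.sum_congr rfl fun j _ => ?_
    rw [← Complex.conj_mul', Complex.star_def]
  have : star (star Q *ᵥ x) ⬝ᵥ (star Q *ᵥ x) = star x ⬝ᵥ x := by
    rw [Matrix.star_mulVec, Matrix.dotProduct_mulVec, Matrix.vecMul_vecMul]
    simp only [Matrix.star_eq_conjTranspose, Matrix.conjTranspose_conjTranspose] at hQQ ⊢
    rw [hQQ, Matrix.vecMul_one]
  rw [h, h] at this
  exact_mod_cast this

lemma exists_common {n : ℕ} {ι : Type*} [Fintype ι] (f : ι → (Fin n → ℂ) →ₗ[ℂ] ℂ)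
    (h : Fintype.card ι < n) : ∃ x : Fin n → ℂ, x ≠ 0 ∧ ∀ i, f i x = 0 := by
  have : LinearMap.ker (LinearMap.pi f) ≠ ⊥ := by
    apply LinearMap.ker_ne_bot_of_finrank_lt
    simpa using h
  obtain ⟨x, hx, hx0⟩ := Submodule.exists_mem_ne_zero_of_ne_bot this
  refine ⟨x, hx0, fun i => ?_⟩
  have := congrFun (LinearMap.mem_ker.1 hx) i
  simpa using this

/-- the row functional -/
def rowf {n : ℕ} (Q : Matrix (Fin n) (Fin n) ℂ) (j : Fin n) : (Fin n → ℂ) →ₗ[ℂ] ℂ :=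
  (LinearMap.proj j).comp (Matrix.mulVecLin (star Q))

lemma rowf_apply {n : ℕ} (Q : Matrix (Fin n) (Fin n) ℂ) (j : Fin n) (x) :
    rowf Q j x = (star Q *ᵥ x) j := rfl

lemma sum_sq_pos {n : ℕ} {x : Fin n → ℂ} (hx : x ≠ 0) : 0 < ∑ j, ‖x j‖ ^ 2 := by
  obtain ⟨j, hj⟩ := Function.ne_iff.1 hx
  refine Finset.sum_pos' (fun i _ => by positivity) ⟨j, Finset.mem_univ _, ?_⟩
  have : 0 < ‖x j‖ := norm_pos_iff.2 hj
  positivity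

/-- If `x` is supported where cos ≥ s. -/
lemma qf_ge {n : ℕ} {w a : Fin n → ℝ} {s : ℝ} (hw : ∀ j, 0 ≤ w j) 
    (h : ∀ j, ¬ s ≤ a j → w j = 0) : s * ∑ j, w j ≤ ∑ j, a j * w j := by
  rw [Finset.mul_sum]
  refine Finset.sum_le_sum fun j _ => ?_
  by_cases hj : s ≤ a j
  · exact mul_le_mul_of_nonneg_right hj (hw j)
  · simp [h j hj]

lemma qf_lt {n : ℕ} {w a : Fin n → ℝ} {s : ℝ} (hw : ∀ j, 0 ≤ w j) (hpos : 0 < ∑ j, w j)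
    (h : ∀ j, s ≤ a j → w j = 0) : ∑ j, a j * w j < s * ∑ j, w j := by
  rw [Finset.mul_sum]
  have : ∃ j, 0 < w j := by
    by_contra hcon
    push Not at hcon
    have : ∑ j, w j ≤ 0 := Finset.sum_nonpos fun j _ => hcon j
    linarith
  obtain ⟨i, hi⟩ := this
  refine Finset.sum_lt_sum (fun j _ => ?_) ⟨i, Finset.mem_univ _, ?_⟩
  · by_cases hj : s ≤ a j
    · simp [h j hj]
    · exact mul_le_mul_of_nonneg_right (not_le.1 hj).le (hw j)
  · have : ¬ s ≤ a i := fun hc => by rw [h i hc] at hi; exact lt_irrefl _ hi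
    exact mul_lt_mul_of_pos_right (not_le.1 this) hi

lemma count1 {n : ℕ} {U U' Q Q' P : Matrix (Fin n) (Fin n) ℂ} {φ φ' : Fin n → ℝ}
    (h : UD U Q φ) (h' : UD U' Q' φ') (k : Fin n)
    (hP : ∀ x, (star P *ᵥ x) k = 0 → U' *ᵥ x = U *ᵥ x) (m s : ℝ) :
    (Finset.univ.filter fun j => s ≤ Real.cos (φ j - m)).card ≤
    (Finset.univ.filter fun j => s ≤ Real.cos (φ' j - m)).card + 1 := by
  classical
  by_contra hcon
  push Not at hcon
  let f : ({j // ¬ s ≤ Real.cos (φ j - m)} ⊕ {j // s ≤ Real.cos (φ' j - m)}) ⊕ Unit →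
      (Fin n → ℂ) →ₗ[ℂ] ℂ :=
    Sum.elim (Sum.elim (fun j => rowf Q j) (fun j => rowf Q' j)) (fun _ => rowf P k)
  obtain ⟨x, hx0, hx⟩ := exists_common f (by
    simp only [Fintype.card_sum, Fintype.card_subtype, Fintype.card_unit]
    have := Finset.card_filter_add_card_filter_not (s := (Finset.univ : Finset (Fin n))) (fun j => s ≤ Real.cos (φ j - m))
    simp only [Finset.card_univ, Fintype.card_fin] at this
    omega)
  have h1 : ∀ j, ¬ s ≤ Real.cos (φ j - m) → (star Q *ᵥ x) j = 0 :=
    fun j hj => hx (Sum.inl (Sum.inl ⟨j, hj⟩))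
  have h2 : ∀ j, s ≤ Real.cos (φ' j - m) → (star Q' *ᵥ x) j = 0 :=
    fun j hj => hx (Sum.inl (Sum.inr ⟨j, hj⟩))
  have h3 := hP x (hx (Sum.inr ()))
  have e1 := h.qf x m
  have e2 := h'.qf x m
  rw [h3, e1] at e2
  have g1 := qf_ge (w := fun j => ‖(star Q *ᵥ x) j‖ ^ 2) (a := fun j => Real.cos (φ j - m)) (s := s)
    (fun j => by positivity) (fun j hj => by simp [h1 j hj])
  have g2 := qf_lt (w := fun j => ‖(star Q' *ᵥ x) j‖ ^ 2) (a := fun j => Real.cos (φ' j - m)) (s := s)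
    (fun j => by positivity) (by rw [norm_sum h'.1]; exact sum_sq_pos hx0) (fun j hj => by simp [h2 j hj])
  rw [norm_sum h.1] at g1
  rw [norm_sum h'.1] at g2
  linarith

lemma angle_tri {n : ℕ} {U V : Matrix (Fin n) (Fin n) ℂ}
    (hU : U ∈ Matrix.unitaryGroup (Fin n) ℂ) (hV : V ∈ Matrix.unitaryGroup (Fin n) ℂ)
    (x : Fin n → ℂ) (N : ℝ) (hN : N = ∑ j, ‖x j‖ ^ 2) (hpos : 0 < N) (r d : ℝ)
    (hr : 0 ≤ r) (hd : 0 ≤ d) (hrd : r + d < Real.pi)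
    (h1 : Real.cos r * N ≤ (star x ⬝ᵥ (U *ᵥ x)).re)
    (h2 : Real.cos d * N ≤ (star x ⬝ᵥ (V *ᵥ x)).re) :
    Real.cos (r + d) * N ≤ (star x ⬝ᵥ ((U * V) *ᵥ x)).re := by
  let T : (Fin n → ℂ) → EuclideanSpace ℂ (Fin n) := fun a => WithLp.toLp 2 a
  have hin : ∀ a b : Fin n → ℂ, inner ℝ (T a) (T b) = (star a ⬝ᵥ b).re := by
    intro a b
    rw [PiLp.inner_apply]
    simp only [dotProduct, Complex.re_sum, Complex.inner, Pi.star_apply, Complex.star_def, T]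
    exact Finset.sum_congr rfl fun j _ => by rw [mul_comm]
  have hnrm : ∀ a : Fin n → ℂ, ‖T a‖ = Real.sqrt (∑ j, ‖a j‖ ^ 2) := by
    intro a
    rw [EuclideanSpace.norm_eq]
  have hsx : ‖T x‖ = Real.sqrt N := by rw [hnrm, hN]
  have hsU : ‖T (star U *ᵥ x)‖ = Real.sqrt N := by rw [hnrm, norm_sum hU, hN]
  have hsV : ‖T (V *ᵥ x)‖ = Real.sqrt N := by
    have := norm_sum (Unitary.star_mem hV) x
    rw [star_star] at this
    rw [hnrm, this, hN]
  have hNN : Real.sqrt N * Real.sqrt N = N := Real.mul_self_sqrt hpos.le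
  have hre : ∀ a b : Fin n → ℂ, (star a ⬝ᵥ b).re = (star b ⬝ᵥ a).re := by
    intro a b
    rw [← hin, ← hin, real_inner_comm]
  have adj : ∀ a b : Fin n → ℂ, star a ⬝ᵥ (star U *ᵥ b) = star (U *ᵥ a) ⬝ᵥ b := by
    intro a b
    rw [Matrix.dotProduct_mulVec, Matrix.star_mulVec, Matrix.star_eq_conjTranspose]
  have a1 : InnerProductGeometry.angle (T (V *ᵥ x)) (T x) ≤ d := by
    unfold InnerProductGeometry.angle
    rw [hsV, hsx, hNN, hin, hre]
    rw [← Real.arccos_cos hd (by linarith)]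
    apply Real.arccos_le_arccos
    rw [le_div_iff₀ hpos]; exact h2
  have a2 : InnerProductGeometry.angle (T x) (T (star U *ᵥ x)) ≤ r := by
    unfold InnerProductGeometry.angle
    rw [hsU, hsx, hNN, hin, adj, hre]
    rw [← Real.arccos_cos hr (by linarith)]
    apply Real.arccos_le_arccos
    rw [le_div_iff₀ hpos]; exact h1
  have a3 := InnerProductGeometry.angle_le_angle_add_angle (T (V *ᵥ x)) (T x) (T (star U *ᵥ x))
  have a4 : InnerProductGeometry.angle (T (V *ᵥ x)) (T (star U *ᵥ x)) ≤ r + d := by linarith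
  have a5 := Real.cos_le_cos_of_nonneg_of_le_pi (InnerProductGeometry.angle_nonneg _ _) hrd.le a4
  rw [InnerProductGeometry.cos_angle, hsV, hsU, hNN, hin, adj, Matrix.mulVec_mulVec, hre, le_div_iff₀ hpos] at a5
  exact a5

lemma countA {n : ℕ} {U V Q Q' R : Matrix (Fin n) (Fin n) ℂ} {φ φ' ψ : Fin n → ℝ}
    (h : UD U Q φ) (hV : UD V R ψ) (h' : UD (U * V) Q' φ') 
    (hφ' : ∀ j, |φ' j| ≤ Real.pi) {r d : ℝ}
    (hr : 0 ≤ r) (hd : 0 ≤ d) (hψ : ∀ j, |ψ j| ≤ d) :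
    (Finset.univ.filter fun j => r + d < |φ' j|).card ≤
    (Finset.univ.filter fun j => r < |φ j|).card := by
  classical
  by_contra hcon
  push Not at hcon
  have hrd : r + d < Real.pi := by
    by_contra hge
    push Not at hge
    have : (Finset.univ.filter fun j => r + d < |φ' j|) = ∅ := by
      apply Finset.filter_eq_empty_iff.2
      intro j _
      have := hφ' j
      linarith
    rw [this] at hcon
    simp at hcon
  let f : ({j // ¬ r + d < |φ' j|} ⊕ {j // r < |φ j|}) → (Fin n → ℂ) →ₗ[ℂ] ℂ :=
    (Sum.elim (fun j => rowf Q' j) (fun j => rowf Q j))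
  obtain ⟨x, hx0, hx⟩ := exists_common f (by
    simp only [Fintype.card_sum, Fintype.card_subtype]
    have := Finset.card_filter_add_card_filter_not (s := (Finset.univ : Finset (Fin n))) (fun j => r + d < |φ' j|)
    simp only [Finset.card_univ, Fintype.card_fin] at this
    omega)
  have h1 : ∀ j, ¬ r + d < |φ' j| → (star Q' *ᵥ x) j = 0 :=
    fun j hj => hx (Sum.inl ⟨j, hj⟩)
  have h2 : ∀ j, r < |φ j| → (star Q *ᵥ x) j = 0 :=
    fun j hj => hx (Sum.inr ⟨j, hj⟩)
  have hpos := sum_sq_pos hx0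
  have e1 := h.qf x 0
  have e2 := h'.qf x 0
  have e3 := hV.qf x 0
  simp only [ofReal_zero, neg_zero, zero_mul, Complex.exp_zero, one_mul, sub_zero] at e1 e2 e3
  have g1 := qf_ge (w := fun j => ‖(star Q *ᵥ x) j‖ ^ 2) (a := fun j => Real.cos (φ j)) (s := Real.cos r)
    (fun j => by positivity) (fun j hj => by
      by_cases hj' : r < |φ j|
      · simp [h2 j hj']
      · exfalso; apply hj
        rw [← Real.cos_abs (φ j)]
        exact Real.cos_le_cos_of_nonneg_of_le_pi (abs_nonneg _) (by linarith) (not_lt.1 hj'))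
  have g3 := qf_ge (w := fun j => ‖(star R *ᵥ x) j‖ ^ 2) (a := fun j => Real.cos (ψ j)) (s := Real.cos d)
    (fun j => by positivity) (fun j hj => by
        exfalso; apply hj
        rw [← Real.cos_abs (ψ j)]
        exact Real.cos_le_cos_of_nonneg_of_le_pi (abs_nonneg _) (by linarith) (hψ j))
  have g2 := qf_lt (w := fun j => ‖(star Q' *ᵥ x) j‖ ^ 2) (a := fun j => Real.cos (φ' j)) (s := Real.cos (r + d))
    (fun j => by positivity) (by rw [norm_sum h'.1]; exact hpos) (fun j hj => by
      by_cases hj' : r + d < |φ' j|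
      · exfalso
        rw [← Real.cos_abs (φ' j)] at hj
        have := Real.cos_lt_cos_of_nonneg_of_le_pi (by linarith : 0 ≤ r + d) (hφ' j) hj'
        linarith
      · simp [h1 j hj'])
  rw [norm_sum h.1, ← e1] at g1
  rw [norm_sum h'.1, ← e2] at g2
  rw [norm_sum hV.1, ← e3] at g3
  have := angle_tri h.mem hV.mem x _ rfl hpos r d hr hd hrd g1 g3
  linarith

open MeasureTheory in
lemma int_st (a b φ : ℝ) (hab : a ≤ b) :
    ∫ x in a..b, (if φ ≤ x then (1:ℝ) else 0) = max (b - max a φ) 0 := by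
  rw [intervalIntegral.integral_of_le hab]
  have h1 : (fun x : ℝ => if φ ≤ x then (1:ℝ) else 0) = (Set.Ici φ).indicator (fun _ => (1:ℝ)) := by
    funext x
    simp [Set.indicator_apply]
  rw [h1, setIntegral_indicator measurableSet_Ici]
  have h2 : (Set.Ioc a b ∩ Set.Ici φ : Set ℝ) =ᵐ[volume] (Set.Ioc a b ∩ Set.Ioi φ : Set ℝ) :=
    (Filter.EventuallyEq.refl _ _).inter Ioi_ae_eq_Ici.symm
  rw [setIntegral_congr_set h2, Set.Ioc_inter_Ioi]
  simp only [integral_const, smul_eq_mul, mul_one, measureReal_restrict_apply_univ, Real.volume_real_Ioc]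

lemma ii_st (a b φ : ℝ) :
    IntervalIntegrable (fun x => (if φ ≤ x then (1:ℝ) else 0)) MeasureTheory.volume a b := by
  apply Monotone.intervalIntegrable
  intro x y hxy
  simp only
  split_ifs <;> linarith

lemma ii_sum {n : ℕ} (f : Fin n → ℝ) (a b : ℝ) :
    IntervalIntegrable (fun x => ∑ j, (if f j ≤ x then (1:ℝ) else 0)) MeasureTheory.volume a b := by
  apply Monotone.intervalIntegrable
  intro x y hxy
  refine Finset.sum_le_sum fun j _ => ?_
  split_ifs <;> linarith

/-- the truncated sum -/
noncomputable def FF {n : ℕ} (c : ℝ) (φ : Fin n → ℝ) : ℝ := ∑ j, max (|φ j| - c) 0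

lemma FF_nonneg {n : ℕ} (c : ℝ) (φ : Fin n → ℝ) : 0 ≤ FF c φ :=
  Finset.sum_nonneg fun _ _ => le_max_right _ _

lemma FF_eq_zero {n : ℕ} (c : ℝ) (φ : Fin n → ℝ) (h : ∀ j, |φ j| ≤ c) : FF c φ = 0 :=
  Finset.sum_eq_zero fun j _ => max_eq_right (by linarith [h j])

lemma FF_shift {n : ℕ} {φ φ' : Fin n → ℝ} (hφ : ∀ j, |φ j| ≤ Real.pi) (hφ' : ∀ j, |φ' j| ≤ Real.pi)
    {c d : ℝ} (hc : 0 ≤ c) (hd : 0 ≤ d)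
    (hcount : ∀ r, 0 ≤ r → (Finset.univ.filter fun j => r + d < |φ' j|).card ≤
      (Finset.univ.filter fun j => r < |φ j|).card) : FF (c + d) φ' ≤ FF c φ := by
  by_cases hcp : Real.pi < c
  · rw [FF_eq_zero (c + d) φ' (fun j => by linarith [hφ' j])]
    exact FF_nonneg _ _
  push Not at hcp
  have e : ∀ ψ : ℝ, ψ ≤ Real.pi → max (ψ - c) 0 =
      (Real.pi - c) - ∫ x in c..Real.pi, (if ψ ≤ x then (1:ℝ) else 0) := by
    intro ψ hψ
    rw [int_st _ _ _ hcp]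
    rcases max_cases (ψ - c) 0 with h | h <;> rcases max_cases c ψ with h' | h' <;>
      rcases max_cases (Real.pi - max c ψ) 0 with h4 | h4 <;> linarith
  have e1 : FF c φ = ∑ j : Fin n, (Real.pi - c) -
      ∫ x in c..Real.pi, ∑ j, (if |φ j| ≤ x then (1:ℝ) else 0) := by
    rw [intervalIntegral.integral_finsetSum (fun j _ => ii_st _ _ _), ← Finset.sum_sub_distrib]
    exact Finset.sum_congr rfl fun j _ => e _ (hφ j)
  have e2 : FF (c + d) φ' = ∑ j : Fin n, (Real.pi - c) -
      ∫ x in c..Real.pi, ∑ j, (if |φ' j| - d ≤ x then (1:ℝ) else 0) := by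
    rw [intervalIntegral.integral_finsetSum (fun j _ => ii_st _ _ _), ← Finset.sum_sub_distrib]
    refine Finset.sum_congr rfl fun j _ => ?_
    rw [← e _ (by linarith [hφ' j])]
    congr 1; ring
  rw [e1, e2]
  have ii : ∀ f : Fin n → ℝ, IntervalIntegrable (fun x => ∑ j, (if f j ≤ x then (1:ℝ) else 0))
      MeasureTheory.volume c Real.pi := by
    exact fun f => ii_sum f _ _
  have := intervalIntegral.integral_mono_on hcp (ii (fun j => |φ j|)) (ii (fun j => |φ' j| - d)) (by
    intro x hx
    have h1 := hcount x (by linarith [hx.1])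
    have h2 := Finset.card_filter_add_card_filter_not (s := (Finset.univ : Finset (Fin n))) (fun j => x + d < |φ' j|)
    have h3 := Finset.card_filter_add_card_filter_not (s := (Finset.univ : Finset (Fin n))) (fun j => x < |φ j|)
    simp only [not_lt] at h2 h3
    rw [← Finset.sum_filter, ← Finset.sum_filter]
    simp only [Finset.sum_const, nsmul_eq_mul, mul_one, sub_le_iff_le_add]
    have : (Finset.univ.filter fun j => |φ j| ≤ x).card ≤ (Finset.univ.filter fun j => |φ' j| ≤ x + d).card := by
      omega
    exact_mod_cast this)
  linarith

lemma rank1_real {n : ℕ} {φ φ' : Fin n → ℝ} (hφ : ∀ j, -Real.pi < φ j ∧ φ j ≤ Real.pi)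
    (hφ' : ∀ j, -Real.pi < φ' j ∧ φ' j ≤ Real.pi) {t : ℝ} (ht0 : 0 < t) (ht1 : t < 2 * Real.pi)
    (k : ℤ) (hk : ∑ j, φ' j = ∑ j, φ j + t + k * (2 * Real.pi))
    (hc1 : ∀ x y, -Real.pi < x → x ≤ y → y < Real.pi →
      (Finset.univ.filter fun j => x ≤ φ j ∧ φ j ≤ y).card ≤
      (Finset.univ.filter fun j => x ≤ φ' j ∧ φ' j ≤ y).card + 1)
    (hc2 : ∀ x y, -Real.pi < x → x ≤ y → y < Real.pi →
      (Finset.univ.filter fun j => x ≤ φ' j ∧ φ' j ≤ y).card ≤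
      (Finset.univ.filter fun j => x ≤ φ j ∧ φ j ≤ y).card + 1) (c : ℝ) (hc : 0 ≤ c) :
    FF c φ' ≤ FF c φ + min t (2 * Real.pi - t) := by
  have hpi := Real.pi_pos
  by_cases hcp : Real.pi < c
  · rw [FF_eq_zero c φ' (fun j => by rw [abs_le]; constructor <;> linarith [hφ' j])]
    have h2 := FF_nonneg c φ
    have : 0 ≤ min t (2 * Real.pi - t) := le_min (by linarith) (by linarith)
    linarith
  push Not at hcp
  -- counting function
  let C : (Fin n → ℝ) → ℝ → ℕ := fun f x => (Finset.univ.filter fun j => f j ≤ x).card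
  let good : ℝ → Prop := fun x => -Real.pi < x ∧ x < Real.pi ∧ (∀ j, φ j ≠ x) ∧ (∀ j, φ' j ≠ x)
  let D : ℝ → ℤ := fun x => (C φ x : ℤ) - C φ' x
  have split : ∀ (f : Fin n → ℝ) x y, x ≤ y → (∀ j, f j ≠ x) →
      C f y = C f x + (Finset.univ.filter fun j => x ≤ f j ∧ f j ≤ y).card := by
    intro f x y hxy hne
    simp only [C]
    rw [← Finset.card_union_of_disjoint]
    · congr 1
      ext j
      simp only [Finset.mem_filter, Finset.mem_univ, true_and, Finset.mem_union]
      constructor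
      · intro h
        rcases le_total (f j) x with h' | h'
        · exact Or.inl h'
        · exact Or.inr ⟨h', h⟩
      · rintro (h | h)
        · linarith
        · exact h.2
    · rw [Finset.disjoint_filter]
      intro j _ h1 h2
      exact hne j (le_antisymm h1 h2.1)
  have hD1 : ∀ x y, x ≤ y → good x → good y → |D y - D x| ≤ 1 := by
    intro x y hxy hx hy
    have s1 := split φ x y hxy hx.2.2.1
    have s2 := split φ' x y hxy hx.2.2.2
    have q1 := hc1 x y hx.1 hxy hy.2.1
    have q2 := hc2 x y hx.1 hxy hy.2.1
    simp only [D]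
    rw [abs_le]
    omega
  have hD : ∀ x y, good x → good y → |D y - D x| ≤ 1 := by
    intro x y hx hy
    rcases le_total x y with h | h
    · exact hD1 x y h hx hy
    · rw [abs_sub_comm]; exact hD1 y x h hy hx
  obtain ⟨m, hm⟩ : ∃ m : ℤ, ∀ x, good x → m ≤ D x ∧ D x ≤ m + 1 := by
    by_cases hex : ∃ x, good x
    · obtain ⟨x0, hx0⟩ := hex
      by_cases hall : ∀ y, good y → D x0 ≤ D y
      · refine ⟨D x0, fun y hy => ⟨hall y hy, ?_⟩⟩
        have := abs_le.1 (hD x0 y hx0 hy)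
        omega
      · push Not at hall
        obtain ⟨y, hy, hlt⟩ := hall
        refine ⟨D y, fun z hz => ?_⟩
        have i1 := abs_le.1 (hD x0 z hx0 hz)
        have i2 := abs_le.1 (hD y z hy hz)
        omega
    · push Not at hex
      exact ⟨0, fun x hx => absurd hx (hex x)⟩
  let E : ℝ → ℝ := fun x => (∑ j, (if φ j ≤ x then (1:ℝ) else 0)) - (∑ j, (if φ' j ≤ x then (1:ℝ) else 0)) - m
  have hE : ∀ x, E x = D x - m := by
    intro x
    simp only [E, D, C]
    rw [← Finset.sum_filter, ← Finset.sum_filter]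
    simp
  have ii : ∀ (f : Fin n → ℝ) a b, IntervalIntegrable (fun x => ∑ j, (if f j ≤ x then (1:ℝ) else 0))
      MeasureTheory.volume a b := by
    exact ii_sum
  have iE : ∀ a b, IntervalIntegrable E MeasureTheory.volume a b := fun a b =>
    ((ii φ a b).sub (ii φ' a b)).sub intervalIntegrable_const
  have hgood : ∀ a b, -Real.pi ≤ a → b ≤ Real.pi →
      ∀ᵐ x ∂(MeasureTheory.volume.restrict (Set.Icc a b)), 0 ≤ E x ∧ E x ≤ 1 := by
    intro a b ha hb
    rw [MeasureTheory.ae_restrict_iff' measurableSet_Icc]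
    have hfin : (Set.range φ ∪ Set.range φ' ∪ {-Real.pi, Real.pi}).Finite :=
      ((Set.finite_range φ).union (Set.finite_range φ')).union (by simp)
    have := hfin.measure_zero MeasureTheory.volume
    rw [MeasureTheory.measure_eq_zero_iff_ae_notMem] at this
    filter_upwards [this] with x hx hx'
    simp only [Set.mem_union, Set.mem_range, Set.mem_insert_iff, Set.mem_singleton_iff, not_or, not_exists] at hx
    have hg : good x := ⟨lt_of_le_of_ne (by linarith [hx'.1]) (Ne.symm hx.2.1), lt_of_le_of_ne (by linarith [hx'.2]) hx.2.2, hx.1.1, hx.1.2⟩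
    have h1 : (m:ℝ) ≤ D x := by exact_mod_cast (hm x hg).1
    have h2 : (D x : ℝ) ≤ m + 1 := by exact_mod_cast (hm x hg).2
    rw [hE]
    constructor <;> linarith
  have I0 : ∀ a b, a ≤ b → -Real.pi ≤ a → b ≤ Real.pi → 0 ≤ ∫ x in a..b, E x := by
    intro a b hab ha hb
    apply intervalIntegral.integral_nonneg_of_ae_restrict hab
    filter_upwards [hgood a b ha hb] with x hx using hx.1
  have I1 : ∀ a b, a ≤ b → -Real.pi ≤ a → b ≤ Real.pi → ∫ x in a..b, E x ≤ b - a := by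
    intro a b hab ha hb
    have := intervalIntegral.integral_mono_ae_restrict hab (iE a b) (intervalIntegrable_const (c := (1:ℝ))) (by
      filter_upwards [hgood a b ha hb] with x hx using hx.2)
    simpa using this
  have IE : ∀ a b, a ≤ b → ∫ x in a..b, E x =
      ∑ j, max (b - max a (φ j)) 0 - ∑ j, max (b - max a (φ' j)) 0 - m * (b - a) := by
    intro a b hab
    simp only [E]
    rw [intervalIntegral.integral_sub ((ii φ a b).sub (ii φ' a b)) intervalIntegrable_const,
      intervalIntegral.integral_sub (ii φ a b) (ii φ' a b),
      intervalIntegral.integral_finsetSum (fun j _ => ii_st _ _ _),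
      intervalIntegral.integral_finsetSum (fun j _ => ii_st _ _ _)]
    simp only [int_st _ _ _ hab, intervalIntegral.integral_const, smul_eq_mul]
    ring
  have tot : ∫ x in (-Real.pi)..Real.pi, E x = t + (k - m : ℤ) * (2 * Real.pi) := by
    rw [IE _ _ (by linarith)]
    have e : ∀ f : Fin n → ℝ, (∀ j, -Real.pi < f j ∧ f j ≤ Real.pi) →
        ∑ j, max (Real.pi - max (-Real.pi) (f j)) 0 = n * Real.pi - ∑ j, f j := by
      intro f hf
      have : (n:ℝ) * Real.pi = ∑ j : Fin n, Real.pi := by simp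
      rw [this, ← Finset.sum_sub_distrib]
      refine Finset.sum_congr rfl fun j _ => ?_
      rw [max_eq_right (hf j).1.le, max_eq_left]
      linarith [hf j]
    rw [e φ hφ, e φ' hφ', hk]
    push_cast
    ring
  have tot' : ∫ x in (-Real.pi)..Real.pi, E x = t := by
    have l := I0 (-Real.pi) Real.pi (by linarith) le_rfl le_rfl
    have u := I1 (-Real.pi) Real.pi (by linarith) le_rfl le_rfl
    rw [tot] at l u
    have : k - m = 0 := by
      have a1 : k - m < 1 := by
        by_contra hcon
        push Not at hcon
        have : (1:ℝ) ≤ (k - m : ℤ) := by exact_mod_cast hcon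
        nlinarith
      have a2 : -1 < k - m := by
        by_contra hcon
        push Not at hcon
        have : ((k - m : ℤ) : ℝ) ≤ -1 := by exact_mod_cast hcon
        nlinarith
      omega
    rw [tot, this]
    simp
  have diff : FF c φ' - FF c φ = (∫ x in c..Real.pi, E x) - ∫ x in (-Real.pi)..(-c), E x := by
    rw [IE _ _ hcp, IE _ _ (by linarith)]
    have e : ∀ f : Fin n → ℝ, (∀ j, -Real.pi < f j ∧ f j ≤ Real.pi) →
        ∑ j, max (Real.pi - max c (f j)) 0 - ∑ j, max (-c - max (-Real.pi) (f j)) 0 = n * (Real.pi - c) - FF c f := by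
      intro f hf
      have : (n:ℝ) * (Real.pi - c) = ∑ j : Fin n, (Real.pi - c) := by simp [mul_sub]
      rw [this, FF, ← Finset.sum_sub_distrib, ← Finset.sum_sub_distrib]
      refine Finset.sum_congr rfl fun j _ => ?_
      rw [max_eq_right (hf j).1.le]
      have hj := hf j
      rcases abs_cases (f j) with h0 | h0 <;> 
      rcases max_cases (|f j| - c) 0 with h | h <;> rcases max_cases c (f j) with h' | h' <;>
      rcases max_cases (Real.pi - max c (f j)) 0 with h4 | h4 <;> 
      rcases max_cases (-c - f j) 0 with h5 | h5 <;> linarith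
    linarith [e φ hφ, e φ' hφ']
  have add1 : (∫ x in (-Real.pi)..(-c), E x) + (∫ x in (-c)..c, E x) + (∫ x in c..Real.pi, E x) = t := by
    rw [intervalIntegral.integral_add_adjacent_intervals (iE _ _) (iE _ _),
      intervalIntegral.integral_add_adjacent_intervals (iE _ _) (iE _ _), tot']
  have p1 := I0 (-Real.pi) (-c) (by linarith) le_rfl (by linarith)
  have p2 := I0 (-c) c (by linarith) (by linarith) (by linarith)
  have p3 := I1 (-c) c (by linarith) (by linarith) (by linarith)
  have p4 := I1 c Real.pi hcp (by linarith) le_rfl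
  have : FF c φ' - FF c φ ≤ min t (2 * Real.pi - t) := le_min (by linarith) (by linarith)
  linarith

lemma arc_iff {φ x y : ℝ} (h1 : -Real.pi < φ) (h2 : φ ≤ Real.pi) (hx : -Real.pi < x) (hxy : x ≤ y)
    (hy : y < Real.pi) :
    Real.cos ((y - x) / 2) ≤ Real.cos (φ - (x + y) / 2) ↔ x ≤ φ ∧ φ ≤ y := by
  have hiff : (x ≤ φ ∧ φ ≤ y) ↔ |φ - (x + y) / 2| ≤ (y - x) / 2 := by
    rw [abs_le]
    constructor
    · rintro ⟨a, b⟩; constructor <;> linarith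
    · rintro ⟨a, b⟩; constructor <;> linarith
  rw [hiff, ← Real.cos_abs (φ - (x + y) / 2)]
  constructor
  · intro h
    by_contra hcon
    push Not at hcon
    rcases le_total (|φ - (x + y) / 2|) Real.pi with hp | hp
    · have := Real.cos_lt_cos_of_nonneg_of_le_pi (by linarith) hp hcon
      linarith
    · have hlt : |φ - (x + y) / 2| < 2 * Real.pi - (y - x) / 2 := by
        rw [abs_lt]; constructor <;> linarith
      have := Real.cos_lt_cos_of_nonneg_of_le_pi (x := (y - x) / 2) (y := 2 * Real.pi - |φ - (x + y) / 2|)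
        (by linarith) (by linarith) (by linarith)
      rw [Real.cos_two_pi_sub] at this
      linarith
  · intro h
    exact Real.cos_le_cos_of_nonneg_of_le_pi (abs_nonneg _) (by linarith) h

/-- truncated sum of absolute arguments as a function of the matrix -/
noncomputable def GG {n : ℕ} (c : ℝ) (W : Matrix (Fin n) (Fin n) ℂ) : ℝ :=
  (W.charpoly.roots.map (fun z => max (|Complex.arg z| - c) 0)).sum

lemma GG_eq {n : ℕ} {W Q : Matrix (Fin n) (Fin n) ℂ} {φ : Fin n → ℝ} (h : UD W Q φ)
    (hφ : ∀ j, -Real.pi < φ j ∧ φ j ≤ Real.pi) (c : ℝ) : GG c W = FF c φ := by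
  unfold GG FF
  rw [h.roots, Multiset.map_map]
  change Finset.sum _ _ = _
  refine Finset.sum_congr rfl fun j _ => ?_
  simp only [Function.comp]
  rw [Complex.exp_mul_I, Complex.arg_cos_add_sin_mul_I (hφ j)]

lemma rank1_mat {n : ℕ} {U P : Matrix (Fin n) (Fin n) ℂ}
    (hU : U ∈ Matrix.unitaryGroup (Fin n) ℂ) (hP : P ∈ Matrix.unitaryGroup (Fin n) ℂ)
    (k : Fin n) (t : ℝ) (ht : |t| ≤ Real.pi) (c : ℝ) (hc : 0 ≤ c) :
    GG c (U * (P * diagonal (fun j => Complex.exp ((if j = k then t else 0 : ℝ) * I)) * star P)) ≤ GG c U + |t| := by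
  by_cases ht0 : t = 0
  · subst ht0
    have : P * star P = 1 := Matrix.mem_unitaryGroup_iff.1 hP
    simp [this]
  set S := P * diagonal (fun j => Complex.exp ((if j = k then t else 0 : ℝ) * I)) * star P with hS
  have hSU : UD S P (fun j => if j = k then t else 0) := ⟨hP, rfl⟩
  have hU' : U * S ∈ Matrix.unitaryGroup (Fin n) ℂ := mul_mem hU hSU.mem
  obtain ⟨Q, φ, h, hφ⟩ := exists_UD U hU
  obtain ⟨Q', φ', h', hφ'⟩ := exists_UD (U * S) hU'
  rw [GG_eq h hφ, GG_eq h' hφ']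
  have hfix : ∀ x, (star P *ᵥ x) k = 0 → (U * S) *ᵥ x = U *ᵥ x := by
    intro x hx
    have : S *ᵥ x = x := by
      rw [hS, ← Matrix.mulVec_mulVec, ← Matrix.mulVec_mulVec]
      have e : diagonal (fun j => Complex.exp ((if j = k then t else 0 : ℝ) * I)) *ᵥ (star P *ᵥ x) = star P *ᵥ x := by
        funext j
        rw [Matrix.mulVec_diagonal]
        by_cases hj : j = k
        · subst hj; rw [hx]; simp
        · simp [hj]
      rw [e, Matrix.mulVec_mulVec, Matrix.mem_unitaryGroup_iff.1 hP, Matrix.one_mulVec]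
    rw [← Matrix.mulVec_mulVec, this]
  have hdet : ∃ m : ℤ, ∑ j, φ' j = ∑ j, φ j + t + m * (2 * Real.pi) := by
    have e := h'.det
    rw [Matrix.det_mul, h.det, hSU.det, ← Complex.exp_add] at e
    simp only [Finset.sum_ite_eq', Finset.mem_univ, if_true] at e
    obtain ⟨m, hm⟩ := Complex.exp_eq_exp_iff_exists_int.1 e.symm
    refine ⟨m, ?_⟩
    have : ((∑ j, φ' j : ℝ) : ℂ) = ((∑ j, φ j + t + m * (2 * Real.pi) : ℝ) : ℂ) := by
      apply mul_right_cancel₀ I_ne_zero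
      rw [hm]
      push_cast
      ring
    exact_mod_cast this
  obtain ⟨m, hm⟩ := hdet
  have hc1 : ∀ x y, -Real.pi < x → x ≤ y → y < Real.pi →
      (Finset.univ.filter fun j => x ≤ φ j ∧ φ j ≤ y).card ≤
      (Finset.univ.filter fun j => x ≤ φ' j ∧ φ' j ≤ y).card + 1 := by
    intro x y hx hxy hy
    have := count1 h h' k hfix ((x + y) / 2) (Real.cos ((y - x) / 2))
    simpa only [arc_iff (hφ _).1 (hφ _).2 hx hxy hy, arc_iff (hφ' _).1 (hφ' _).2 hx hxy hy] using this
  have hc2 : ∀ x y, -Real.pi < x → x ≤ y → y < Real.pi →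
      (Finset.univ.filter fun j => x ≤ φ' j ∧ φ' j ≤ y).card ≤
      (Finset.univ.filter fun j => x ≤ φ j ∧ φ j ≤ y).card + 1 := by
    intro x y hx hxy hy
    have := count1 h' h k (fun x hx => (hfix x hx).symm) ((x + y) / 2) (Real.cos ((y - x) / 2))
    simpa only [arc_iff (hφ _).1 (hφ _).2 hx hxy hy, arc_iff (hφ' _).1 (hφ' _).2 hx hxy hy] using this
  have hpi := Real.pi_pos
  rcases lt_or_gt_of_ne ht0 with hneg | hpos
  · rw [abs_of_neg hneg] at ht ⊢
    have := rank1_real hφ hφ' (t := t + 2 * Real.pi) (by linarith) (by linarith) (m - 1)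
      (by rw [hm]; push_cast; ring) hc1 hc2 c hc
    have h2 := min_le_right (t + 2 * Real.pi) (2 * Real.pi - (t + 2 * Real.pi))
    linarith
  · rw [abs_of_pos hpos] at ht ⊢
    have := rank1_real hφ hφ' hpos (by linarith) m hm hc1 hc2 c hc
    have h2 := min_le_left t (2 * Real.pi - t)
    linarith

lemma diag_mul {n : ℕ} {P : Matrix (Fin n) (Fin n) ℂ} (hP : P ∈ Matrix.unitaryGroup (Fin n) ℂ)
    (a b : Fin n → ℝ) :
    (P * diagonal (fun j => Complex.exp (a j * I)) * star P) *
    (P * diagonal (fun j => Complex.exp (b j * I)) * star P) =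
    P * diagonal (fun j => Complex.exp ((a j + b j : ℝ) * I)) * star P := by
  have h1 : star P * P = 1 := Matrix.mem_unitaryGroup_iff'.1 hP
  have h2 : diagonal (fun j => Complex.exp ((a j + b j : ℝ) * I)) =
      diagonal (fun j => Complex.exp (a j * I)) * diagonal (fun j => Complex.exp (b j * I)) := by
    rw [Matrix.diagonal_mul_diagonal]
    congr 1
    funext j
    rw [← Complex.exp_add]; congr 1; push_cast; ring
  rw [h2]
  simp only [mul_assoc]
  rw [← mul_assoc (star P) P, h1, one_mul]

lemma trace_step {n : ℕ} {U P : Matrix (Fin n) (Fin n) ℂ}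
    (hU : U ∈ Matrix.unitaryGroup (Fin n) ℂ) (hP : P ∈ Matrix.unitaryGroup (Fin n) ℂ)
    (κ : Fin n → ℝ) (hκ : ∀ j, |κ j| ≤ Real.pi) (c : ℝ) (hc : 0 ≤ c) (s : Finset (Fin n)) :
    GG c (U * (P * diagonal (fun j => Complex.exp ((if j ∈ s then κ j else 0 : ℝ) * I)) * star P)) ≤
      GG c U + ∑ j ∈ s, |κ j| := by
  classical
  induction s using Finset.induction_on with
  | empty =>
    have : P * star P = 1 := Matrix.mem_unitaryGroup_iff.1 hP
    simp [this]
  | insert k s hk ih =>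
    have hSU : UD (P * diagonal (fun j => Complex.exp ((if j ∈ s then κ j else 0 : ℝ) * I)) * star P) P
      (fun j => if j ∈ s then κ j else 0) := ⟨hP, rfl⟩
    have := rank1_mat (mul_mem hU hSU.mem) hP k (κ k) (hκ k) c hc
    rw [mul_assoc, diag_mul hP] at this
    have e : (fun j => Complex.exp (((if j ∈ s then κ j else 0) + (if j = k then κ k else 0) : ℝ) * I)) =
        (fun j => Complex.exp ((if j ∈ insert k s then κ j else 0 : ℝ) * I)) := by
      funext j
      by_cases hj : j = k
      · subst hj; simp [hk]
      · simp [hj]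
    rw [e] at this
    rw [Finset.sum_insert hk]
    linarith

lemma GG_main {n : ℕ} {U V : Matrix (Fin n) (Fin n) ℂ}
    (hU : U ∈ Matrix.unitaryGroup (Fin n) ℂ) (hV : V ∈ Matrix.unitaryGroup (Fin n) ℂ)
    {c d : ℝ} (hc : 0 ≤ c) (hd : 0 ≤ d) : GG (c + d) (U * V) ≤ GG c U + GG d V := by
  obtain ⟨P, ψ, h, hψ⟩ := exists_UD V hV
  let δ : Fin n → ℝ := fun j => max (-d) (min d (ψ j))
  let κ : Fin n → ℝ := fun j => ψ j - δ j
  have hδ : ∀ j, |δ j| ≤ d := by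
    intro j
    rw [abs_le]
    exact ⟨le_max_left _ _, max_le (by linarith) (min_le_left _ _)⟩
  have hκ : ∀ j, |κ j| = max (|ψ j| - d) 0 := by
    intro j
    simp only [κ, δ]
    rcases abs_cases (ψ j) with h0 | h0 <;> rcases min_cases d (ψ j) with h1 | h1 <;>
      rcases max_cases (-d) (min d (ψ j)) with h2 | h2 <;>
      rcases abs_cases (ψ j - max (-d) (min d (ψ j))) with h3 | h3 <;>
      rcases max_cases (|ψ j| - d) 0 with h4 | h4 <;> linarith
  have hψ' : ∀ j, |ψ j| ≤ Real.pi := fun j => abs_le.2 ⟨(hψ j).1.le, (hψ j).2⟩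
  have hκ' : ∀ j, |κ j| ≤ Real.pi := by
    intro j
    rw [hκ]
    exact max_le (by linarith [hψ' j]) Real.pi_pos.le
  have hPm := h.1
  have st := trace_step hU hPm κ hκ' c hc Finset.univ
  simp only [Finset.mem_univ, if_true] at st
  set K := P * diagonal (fun j => Complex.exp (κ j * I)) * star P with hK
  set Δ := P * diagonal (fun j => Complex.exp (δ j * I)) * star P with hΔ
  have hKu : UD K P κ := ⟨hPm, rfl⟩
  have hΔu : UD Δ P δ := ⟨hPm, rfl⟩
  have hVe : V = K * Δ := by
    rw [hK, hΔ, diag_mul hPm, h.2]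
    simp [κ]
  have e1 : GG d V = ∑ j, |κ j| := by
    rw [GG_eq h hψ, FF]
    exact Finset.sum_congr rfl fun j _ => (hκ j).symm
  have hUK := mul_mem hU hKu.mem
  obtain ⟨Q, φ, hq, hφ⟩ := exists_UD (U * K) hUK
  obtain ⟨Q', φ', hq', hφ'⟩ := exists_UD (U * K * Δ) (mul_mem hUK hΔu.mem)
  have hφa : ∀ j, |φ j| ≤ Real.pi := fun j => abs_le.2 ⟨(hφ j).1.le, (hφ j).2⟩
  have hφa' : ∀ j, |φ' j| ≤ Real.pi := fun j => abs_le.2 ⟨(hφ' j).1.le, (hφ' j).2⟩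
  have := FF_shift hφa hφa' hc hd (fun r hr => countA hq hΔu hq' hφa' hr hd hδ)
  rw [← GG_eq hq hφ, ← GG_eq hq' hφ', mul_assoc, ← hVe] at this
  linarith

lemma abel_aux : ∀ (n : ℕ) (μ x : Fin n → ℝ), Antitone μ →
    (∀ k, 0 ≤ ∑ j, if j ≤ k then x j else 0) → ∀ M, (∀ j, M ≤ μ j) →
    M * ∑ j, x j ≤ ∑ j, μ j * x j := by
  intro n
  induction n with
  | zero => intro μ x _ _ M _; simp
  | succ n ih =>
    intro μ x hμ hx M hM
    have h1 := ih (fun j => μ j.castSucc) (fun j => x j.castSucc)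
      (fun a b hab => hμ (by simpa using hab)) (fun k => by
        have := hx k.castSucc
        rw [Fin.sum_univ_castSucc] at this
        simpa [Fin.castSucc_lt_last, not_le.2 (Fin.castSucc_lt_last k)] using this)
      (μ (Fin.last n)) (fun j => hμ (Fin.le_last _))
    have h2 := hx (Fin.last n)
    simp only [Fin.le_last, if_true] at h2
    have h3 := mul_le_mul_of_nonneg_right (hM (Fin.last n)) h2
    rw [Fin.sum_univ_castSucc (fun j => μ j * x j)]
    have h4 : ∑ j, x j = ∑ j : Fin n, x j.castSucc + x (Fin.last n) := Fin.sum_univ_castSucc _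
    refine h3.trans ?_
    rw [h4, mul_add]
    linarith

lemma partial_sums {n : ℕ} {a b e : Fin n → ℝ} (ha : Antitone a) (hb : Antitone b)
    (ha0 : ∀ j, 0 ≤ a j) (hb0 : ∀ j, 0 ≤ b j)
    (h : ∀ c d, 0 ≤ c → 0 ≤ d → ∑ j, max (e j - (c + d)) 0 ≤ ∑ j, max (a j - c) 0 + ∑ j, max (b j - d) 0)
    (k : Fin n) : 0 ≤ ∑ j, if j ≤ k then a j + b j - e j else 0 := by
  have key : ∀ f : Fin n → ℝ, Antitone f → ∀ j, max (f j - f k) 0 = if j ≤ k then f j - f k else 0 := by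
    intro f hf j
    split_ifs with hj
    · exact max_eq_left (by linarith [hf hj])
    · exact max_eq_right (by linarith [hf (not_le.1 hj).le])
  have h1 := h (a k) (b k) (ha0 k) (hb0 k)
  rw [Finset.sum_congr rfl (fun j _ => key a ha j), Finset.sum_congr rfl (fun j _ => key b hb j),
    ← Finset.sum_add_distrib] at h1
  rw [← sub_nonneg, ← Finset.sum_sub_distrib] at h1
  refine h1.trans (Finset.sum_le_sum fun j _ => ?_)
  have q1 := le_max_left (e j - (a k + b k)) 0
  have q2 := le_max_right (e j - (a k + b k)) 0
  split_ifs <;> linarith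

lemma absArgs_ofFn {n : ℕ} {W : Matrix (Fin n) (Fin n) ℂ} (hW : W ∈ Matrix.unitaryGroup (Fin n) ℂ) :
    absArgs W = List.ofFn (fun j : Fin n => (absArgs W).getD j 0) := by
  obtain ⟨Q, φ, h, -⟩ := exists_UD W hW
  have hlen : (absArgs W).length = n := by
    simp [absArgs, h.roots]
  apply List.ext_getElem
  · simp [hlen]
  · intro i h1 h2
    rw [List.getElem_ofFn, List.getD_eq_getElem _ _ h1]

lemma absArgs_anti {n : ℕ} {W : Matrix (Fin n) (Fin n) ℂ} (hW : W ∈ Matrix.unitaryGroup (Fin n) ℂ) :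
    Antitone (fun j : Fin n => (absArgs W).getD j 0) := by
  have h : (absArgs W).Pairwise (· ≥ ·) := Multiset.pairwise_sort _ _
  rw [absArgs_ofFn hW, List.pairwise_ofFn] at h
  intro i j hij
  rcases hij.lt_or_eq with h' | h'
  · exact h h'
  · rw [h']

lemma absArgs_nonneg {n : ℕ} (W : Matrix (Fin n) (Fin n) ℂ) (j : ℕ) : 0 ≤ (absArgs W).getD j 0 := by
  by_cases hj : j < (absArgs W).length
  · rw [List.getD_eq_getElem _ _ hj]
    have := List.getElem_mem hj
    generalize (absArgs W)[j] = y at this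
    rw [absArgs, Multiset.mem_sort, Multiset.mem_map] at this
    obtain ⟨z, -, rfl⟩ := this
    exact abs_nonneg _
  · rw [List.getD_eq_default _ _ (not_lt.1 hj)]

lemma absArgs_GG {n : ℕ} {W : Matrix (Fin n) (Fin n) ℂ} (hW : W ∈ Matrix.unitaryGroup (Fin n) ℂ)
    (c : ℝ) : ∑ j : Fin n, max ((absArgs W).getD j 0 - c) 0 = GG c W := by
  have h1 : ((absArgs W).map (fun y => max (y - c) 0)).sum = GG c W := by
    have : ((absArgs W : List ℝ) : Multiset ℝ) = W.charpoly.roots.map (fun z => |Complex.arg z|) :=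
      Multiset.sort_eq _ _
    rw [← Multiset.sum_coe, ← Multiset.map_coe, this, Multiset.map_map]
    rfl
  rw [← h1, absArgs_ofFn hW, List.map_ofFn, List.sum_ofFn, ← absArgs_ofFn hW]
  rfl

theorem stmt3 {n : ℕ} (μ : Fin n → ℝ) (hμ : Antitone μ) (hμ0 : ∀ j, 0 ≤ μ j)
    (U V : Matrix (Fin n) (Fin n) ℂ)
    (hU : U ∈ Matrix.unitaryGroup (Fin n) ℂ) (hV : V ∈ Matrix.unitaryGroup (Fin n) ℂ) :
    nu μ (U * V) ≤ nu μ U + nu μ V := by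
  have hUV := mul_mem hU hV
  have h := abel_aux n μ _ hμ (partial_sums (absArgs_anti hU) (absArgs_anti hV)
    (fun j => absArgs_nonneg U j) (fun j => absArgs_nonneg V j)
    (e := fun j : Fin n => (absArgs (U * V)).getD j 0) (by
      intro c d hc hd
      rw [absArgs_GG hU, absArgs_GG hV, absArgs_GG hUV]
      exact GG_main hU hV hc hd)) 0 hμ0
  rw [zero_mul] at h
  unfold nu
  rw [← Finset.sum_add_distrib, ← sub_nonneg, ← Finset.sum_sub_distrib]
  refine h.trans (le_of_eq (Finset.sum_congr rfl fun j _ => ?_))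
  ring
end

section
/- Let μ_1 ≥ ... ≥ μ_n ≥ 0 with μ ≠ 0 and define d_μ(U, V) = ν_μ(U V⁻¹), where ν_μ(W) = Σ_j μ_j θ_j^↓(W) with θ_j^↓(W) the absolute principal arguments of eigenvalues of W in descending order. Then d_μ is a metric on the group of n×n unitary matrices: it is nonnegative, vanishes exactly when U = V, is symmetric, and satisfies the triangle inequality. -/
open Complex Matrix

/-- The unitary matrix with eigenvectors the columns of `X` and eigenvalue arguments `θ`. -/
noncomputable def Dg {n : ℕ} (X : Matrix (Fin n) (Fin n) ℂ) (θ : Fin n → ℝ) :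
    Matrix (Fin n) (Fin n) ℂ :=
  X * diagonal (fun j => Complex.exp (θ j * I)) * Xᴴ

lemma abs_arg_exp {t : ℝ} (ht : |t| ≤ Real.pi) : |Complex.arg (Complex.exp (t * I))| = |t| := by
  rw [abs_le] at ht
  rcases eq_or_lt_of_le ht.1 with h | h
  · rw [← h]
    have : Complex.exp (((-Real.pi : ℝ) : ℂ) * I) = -1 := by
      push_cast
      rw [neg_mul, Complex.exp_neg, Complex.exp_pi_mul_I]; norm_num
    rw [this, Complex.arg_neg_one, abs_neg]
  · rw [Complex.arg_exp_mul_I, (toIocMod_eq_self _).2]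
    constructor <;> linarith [ht.2]

lemma absArgs_Dg {n : ℕ} {X : Matrix (Fin n) (Fin n) ℂ} (hX : Xᴴ * X = 1) {θ : Fin n → ℝ}
    (hθ : ∀ i, |θ i| ≤ Real.pi) (ha : Antitone fun i => |θ i|) :
    absArgs (Dg X θ) = List.ofFn fun i => |θ i| := by
  have h1 : (Dg X θ).charpoly = ∏ i, (Polynomial.X - Polynomial.C (Complex.exp (θ i * I))) := by
    rw [Dg, charpoly_mul_comm, ← mul_assoc, hX, one_mul, charpoly_diagonal]
  have h2 : (Dg X θ).charpoly.roots.map (fun z => |Complex.arg z|)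
      = Finset.univ.val.map (fun i => |θ i|) := by
    rw [h1, Polynomial.roots_prod]
    · simp only [Polynomial.roots_X_sub_C, Multiset.bind_singleton, Multiset.map_map]
      exact Multiset.map_congr rfl fun i _ => abs_arg_exp (hθ i)
    · exact Finset.prod_ne_zero_iff.2 fun i _ => Polynomial.X_sub_C_ne_zero _
  rw [absArgs, h2]
  apply List.Perm.eq_of_pairwise' (r := (· ≥ ·))
  · exact Multiset.pairwise_sort _ _
  · exact ha.sortedGE_ofFn.pairwise
  · rw [← Multiset.coe_eq_coe, Multiset.sort_eq]
    simp [List.ofFn_eq_map]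

lemma nu_Dg {n : ℕ} (μ : Fin n → ℝ) {X : Matrix (Fin n) (Fin n) ℂ} (hX : Xᴴ * X = 1)
    {θ : Fin n → ℝ}
    (hθ : ∀ i, |θ i| ≤ Real.pi) (ha : Antitone fun i => |θ i|) :
    nu μ (Dg X θ) = ∑ i, μ i * |θ i| := by
  rw [nu, absArgs_Dg hX hθ ha]
  exact Finset.sum_congr rfl fun i _ => by simp

lemma exists_cayley {n : ℕ} (W : Matrix (Fin n) (Fin n) ℂ) :
    ∃ c : ℂ, c * star c = 1 ∧ IsUnit (scalar (Fin n) c + W) := by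
  have hinf : (Metric.sphere (0:ℂ) 1).Infinite := by
    refine Set.Infinite.of_image Complex.arg ((Set.Ioc_infinite (by
      linarith [Real.pi_pos] : -Real.pi < Real.pi)).mono ?_)
    intro t ht
    refine ⟨Complex.exp (t * I), ?_, ?_⟩
    · simp [Complex.norm_exp_ofReal_mul_I]
    · rw [Complex.arg_exp_mul_I, (toIocMod_eq_self _).2]
      constructor <;> linarith [ht.1, ht.2]
  obtain ⟨c, hc, hc'⟩ := hinf.exists_notMem_finset ((-W).charpoly.roots.toFinset)
  refine ⟨c, ?_, ?_⟩
  · have : ‖c‖ = 1 := by simpa using hc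
    change c * (starRingEnd ℂ) c = 1
    rw [Complex.mul_conj, Complex.normSq_eq_norm_sq, this]; norm_num
  · rw [Matrix.isUnit_iff_isUnit_det, isUnit_iff_ne_zero]
    intro h
    apply hc'
    rw [Multiset.mem_toFinset, Polynomial.mem_roots (charpoly_monic _).ne_zero]
    rw [Polynomial.IsRoot, Matrix.eval_charpoly, sub_neg_eq_add, h]

lemma spectral {n : ℕ} {W : Matrix (Fin n) (Fin n) ℂ} (hW : W * Wᴴ = 1) :
    ∃ (X : Matrix (Fin n) (Fin n) ℂ) (θ : Fin n → ℝ), Xᴴ * X = 1 ∧ X * Xᴴ = 1 ∧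
      (∀ i, |θ i| ≤ Real.pi) ∧ (Antitone fun i => |θ i|) ∧ W = Dg X θ := by
  have hW' : Wᴴ * W = 1 := mul_eq_one_comm.1 hW
  -- unsorted version suffices
  suffices h : ∃ (X : Matrix (Fin n) (Fin n) ℂ) (θ : Fin n → ℝ), Xᴴ * X = 1 ∧ X * Xᴴ = 1 ∧
      (∀ i, |θ i| ≤ Real.pi) ∧ W = Dg X θ by
    obtain ⟨X, θ, h1, h2, h3, h4⟩ := h
    let σ := Tuple.sort fun i => - |θ i|
    have hs := Tuple.monotone_sort fun i => - |θ i|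
    refine ⟨X.submatrix id σ, θ ∘ σ, ?_, ?_, fun i => h3 _, ?_, ?_⟩
    · rw [conjTranspose_submatrix, ← submatrix_mul Xᴴ X σ id σ Function.bijective_id, h1]
      simp
    · rw [conjTranspose_submatrix, submatrix_mul_equiv X Xᴴ id σ id, h2]
      simp
    · intro i j hij
      have := hs hij
      simp only [Function.comp] at this ⊢
      linarith
    · rw [h4, Dg, Dg]
      have : diagonal (fun j => Complex.exp (((θ ∘ σ) j : ℝ) * I))
        = (diagonal (fun j => Complex.exp (θ j * I))).submatrix σ σ := by
        rw [submatrix_diagonal_equiv]; rfl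
      rw [this, conjTranspose_submatrix, submatrix_mul_equiv, submatrix_mul_equiv]
      simp
  obtain ⟨c, hc, hu⟩ := exists_cayley W
  set S := scalar (Fin n) c with hS
  set T := scalar (Fin n) (star c) with hT
  have hST : S * T = 1 := by rw [hS, hT, ← map_mul, hc, map_one]
  have hTS : T * S = 1 := mul_eq_one_comm.1 hST
  have hSH : Sᴴ = T := by
    rw [hS, hT, scalar_apply, scalar_apply, diagonal_conjTranspose]
    rfl
  have hTH : Tᴴ = S := by rw [← hSH, conjTranspose_conjTranspose]
  have comS : ∀ M, S * M = M * S := fun M => (scalar_commute c (fun _ => Commute.all _ _) M).eq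
  have comT : ∀ M, T * M = M * T := fun M => (scalar_commute (star c) (fun _ => Commute.all _ _) M).eq
  obtain ⟨B, hB1, hB2⟩ : ∃ B, (S + W) * B = 1 ∧ B * (S + W) = 1 := by
    obtain ⟨u, hu⟩ := hu
    exact ⟨((u⁻¹ : (Matrix (Fin n) (Fin n) ℂ)ˣ) : Matrix (Fin n) (Fin n) ℂ), by rw [← hu]; simp, by rw [← hu]; simp⟩
  have hB3 : (T + Wᴴ) * Bᴴ = 1 := by
    have := congrArg conjTranspose hB2
    simpa [conjTranspose_mul, conjTranspose_add, hSH] using this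
  have hB4 : Bᴴ * (T + Wᴴ) = 1 := mul_eq_one_comm.1 hB3
  have hkey : Bᴴ * (Wᴴ - T) = - ((W - S) * B) := by
    have e : (Wᴴ - T) * (S + W) = - ((T + Wᴴ) * (W - S)) := by
      simp only [sub_mul, mul_add, add_mul, mul_sub, hTS, hW']
      abel
    calc Bᴴ * (Wᴴ - T) = Bᴴ * ((Wᴴ - T) * (S + W)) * B := by
          rw [mul_assoc, mul_assoc, hB1, mul_one]
      _ = _ := by rw [e, mul_neg, ← mul_assoc, hB4, one_mul, neg_mul]
  let A : Matrix (Fin n) (Fin n) ℂ := (-I) • ((W - S) * B)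
  have hA : A.IsHermitian := by
    change ((-I) • ((W - S) * B))ᴴ = _
    rw [conjTranspose_smul, conjTranspose_mul, conjTranspose_sub, hSH, hkey]
    simp [A]
  have hIA : I • A = (W - S) * B := by simp [A, smul_smul]
  have hWA : W * (1 - I • A) = S * (1 + I • A) := by
    rw [hIA]
    have e1 : (1 : Matrix (Fin n) (Fin n) ℂ) - (W - S) * B = (2:ℂ) • (S * B) := by
      rw [← hB1, two_smul]; noncomm_ring
    have e2 : (1 : Matrix (Fin n) (Fin n) ℂ) + (W - S) * B = (2:ℂ) • (W * B) := by
      rw [← hB1, two_smul]; noncomm_ring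
    rw [e1, e2, Matrix.mul_smul, Matrix.mul_smul, ← mul_assoc, ← mul_assoc, comS]
  let X : Matrix (Fin n) (Fin n) ℂ := hA.eigenvectorUnitary
  have hX1 : Xᴴ * X = 1 := Unitary.coe_star_mul_self hA.eigenvectorUnitary
  have hX2 : X * Xᴴ = 1 := Unitary.coe_mul_star_self hA.eigenvectorUnitary
  have hspec : A = X * diagonal (fun i => (hA.eigenvalues i : ℂ)) * Xᴴ := by
    have := hA.spectral_theorem
    rw [Unitary.conjStarAlgAut_apply] at this
    exact this
  set l := hA.eigenvalues with hl
  have hne : ∀ i, (1 : ℂ) - I * l i ≠ 0 := by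
    intro i h
    have := congrArg Complex.re h
    simp at this
  set E := Xᴴ * W * X with hE
  have hWE : W = X * E * Xᴴ := by
    rw [hE]
    calc W = (X * Xᴴ) * W * (X * Xᴴ) := by rw [hX2]; simp
      _ = _ := by noncomm_ring
  have hD : Xᴴ * (I • A) * X = diagonal (fun i => I * (l i : ℂ)) := by
    rw [hspec, Matrix.mul_smul, Matrix.smul_mul]
    have : Xᴴ * (X * diagonal (fun i => (l i : ℂ)) * Xᴴ) * X
       = (Xᴴ * X) * diagonal (fun i => (l i : ℂ)) * (Xᴴ * X) := by noncomm_ring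
    rw [this, hX1, one_mul, mul_one]
    ext i j
    by_cases h : i = j <;> simp [diagonal, h]
  have hED : E * diagonal (fun i => 1 - I * (l i : ℂ)) = diagonal (fun i => c * (1 + I * (l i : ℂ))) := by
    have e1 : diagonal (fun i => 1 - I * (l i : ℂ)) = Xᴴ * (1 - I • A) * X := by
      rw [mul_sub, sub_mul, hD, mul_one, hX1, ← diagonal_one, diagonal_sub]
    have e2 : diagonal (fun i => c * (1 + I * (l i : ℂ))) = Xᴴ * (S * (1 + I • A)) * X := by
      have : Xᴴ * (S * (1 + I • A)) * X = S * (Xᴴ * (1 + I • A) * X) := by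
        rw [← mul_assoc, ← comS]; noncomm_ring
      rw [this, mul_add, add_mul, hD, mul_one, hX1, ← diagonal_one, diagonal_add, hS, scalar_apply,
        diagonal_mul_diagonal]
    rw [e1, e2, ← hWA, hE]
    calc Xᴴ * W * X * (Xᴴ * (1 - I • A) * X) = Xᴴ * W * (X * Xᴴ) * (1 - I • A) * X := by noncomm_ring
      _ = _ := by rw [hX2]; noncomm_ring
  let z : Fin n → ℂ := fun i => c * (1 + I * (l i : ℂ)) / (1 - I * (l i : ℂ))
  have hEz : E = diagonal z := by
    ext i j
    have := congrFun (congrFun hED i) j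
    rw [mul_diagonal] at this
    rw [eq_div_of_mul_eq (hne j) this]
    by_cases h : i = j
    · subst h; simp [z]
    · simp [diagonal, h]
  have hEE : E * Eᴴ = 1 := by
    rw [hE, conjTranspose_mul, conjTranspose_mul, conjTranspose_conjTranspose]
    calc Xᴴ * W * X * (Xᴴ * (Wᴴ * X)) = Xᴴ * W * (X * Xᴴ) * Wᴴ * X := by noncomm_ring
      _ = Xᴴ * (W * Wᴴ) * X := by rw [hX2]; noncomm_ring
      _ = 1 := by rw [hW]; simp [hX1]
  have hz : ∀ i, ‖z i‖ = 1 := by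
    intro i
    have := congrFun (congrFun hEE i) i
    rw [hEz, diagonal_conjTranspose, diagonal_mul_diagonal, diagonal_apply_eq, one_apply_eq] at this
    have h2 : z i * (starRingEnd ℂ) (z i) = 1 := this
    rw [Complex.mul_conj, Complex.normSq_eq_norm_sq] at h2
    have h3 : ‖z i‖ ^ 2 = 1 := by exact_mod_cast h2
    nlinarith [norm_nonneg (z i)]
  refine ⟨X, fun i => (z i).arg, hX1, hX2, fun i => Complex.abs_arg_le_pi _, ?_⟩
  rw [hWE, hEz, Dg]
  congr 3
  ext i
  conv_lhs => rw [← Complex.norm_mul_exp_arg_mul_I (z i), hz i]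
  simp

lemma doubly_rearr {n : ℕ} {μ a : Fin n → ℝ} (hμ : Antitone μ) (ha : Antitone a)
    {P : Matrix (Fin n) (Fin n) ℝ} (hP : P ∈ doublyStochastic ℝ (Fin n)) :
    ∑ i, μ i * ∑ j, P i j * a j ≤ ∑ i, μ i * a i := by
  obtain ⟨w, hw0, hw1, hw⟩ := exists_eq_sum_perm_of_mem_doublyStochastic hP
  have hmv : Monovary μ a := hμ.monovary ha
  have key : ∀ σ : Equiv.Perm (Fin n),
      ∑ i, μ i * ∑ j, (σ.permMatrix ℝ) i j * a j ≤ ∑ i, μ i * a i := by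
    intro σ
    refine le_trans (le_of_eq ?_) (hmv.sum_mul_comp_perm_le_sum_mul (σ := σ))
    refine Finset.sum_congr rfl fun i _ => ?_
    congr 1
    simp [Equiv.Perm.permMatrix, PEquiv.toMatrix_apply]
  calc ∑ i, μ i * ∑ j, P i j * a j
      = ∑ σ, w σ * ∑ i, μ i * ∑ j, (σ.permMatrix ℝ) i j * a j := by
        rw [← hw]
        simp only [Matrix.sum_apply, Matrix.smul_apply, smul_eq_mul, Finset.sum_mul, Finset.mul_sum]
        symm
        rw [Finset.sum_comm]
        refine Finset.sum_congr rfl fun i _ => ?_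
        rw [Finset.sum_comm]
        refine Finset.sum_congr rfl fun j _ => Finset.sum_congr rfl fun σ _ => ?_
        ring
    _ ≤ ∑ σ, w σ * ∑ i, μ i * a i :=
        Finset.sum_le_sum fun σ _ => mul_le_mul_of_nonneg_left (key σ) (hw0 σ)
    _ = _ := by rw [← Finset.sum_mul, hw1, one_mul]

lemma normSq_doubly {n : ℕ} {Z : Matrix (Fin n) (Fin n) ℂ} (h1 : Zᴴ * Z = 1) (h2 : Z * Zᴴ = 1) :
    (Matrix.of fun i j => Complex.normSq (Z j i)) ∈ doublyStochastic ℝ (Fin n) := by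
  rw [mem_doublyStochastic_iff_sum]
  refine ⟨fun i j => Complex.normSq_nonneg _, fun i => ?_, fun j => ?_⟩
  · have := congrFun (congrFun h1 i) i
    rw [mul_apply, one_apply_eq] at this
    simp only [conjTranspose_apply] at this
    have h : ∀ j, star (Z j i) * Z j i = ((Complex.normSq (Z j i) : ℝ) : ℂ) :=
      fun j => (Complex.normSq_eq_conj_mul_self).symm
    simp only [h] at this
    simp only [of_apply]
    exact_mod_cast this
  · have := congrFun (congrFun h2 j) j
    rw [mul_apply, one_apply_eq] at this
    simp only [conjTranspose_apply] at this
    have h : ∀ i, Z j i * star (Z j i) = ((Complex.normSq (Z j i) : ℝ) : ℂ) :=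
      fun i => Complex.mul_conj _
    simp only [h] at this
    simp only [of_apply]
    exact_mod_cast this

lemma cos_bound {x : ℝ} (hx : |x| ≤ Real.pi) : x ^ 2 ≤ Real.pi ^ 2 / 2 * (1 - Real.cos x) := by
  have h := Real.cos_le_one_sub_mul_cos_sq hx
  have hp := Real.pi_pos
  have : 2 / Real.pi ^ 2 * x ^ 2 ≤ 1 - Real.cos x := by linarith
  calc x ^ 2 = Real.pi ^ 2 / 2 * (2 / Real.pi ^ 2 * x ^ 2) := by field_simp
    _ ≤ _ := by gcongr

lemma abs_diff_sq {s t : ℝ} (hs : |s| ≤ Real.pi) (ht : |t| ≤ Real.pi) :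
    (|s| - |t|) ^ 2 ≤ Real.pi ^ 2 / 2 * (1 - Real.cos (s - t)) := by
  have h1 : |(|s| - |t|)| ≤ Real.pi := by
    rw [abs_le]; constructor <;> linarith [abs_nonneg s, abs_nonneg t]
  refine (cos_bound h1).trans ?_
  have : Real.cos (s - t) ≤ Real.cos (|s| - |t|) := by
    rw [Real.cos_sub, Real.cos_sub, Real.cos_abs, Real.cos_abs]
    have h : Real.sin s * Real.sin t ≤ |Real.sin s| * |Real.sin t| := by
      rw [← abs_mul]; exact le_abs_self _
    have e : ∀ u : ℝ, |u| ≤ Real.pi → |Real.sin u| = Real.sin |u| := fun u hu =>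
      Real.abs_sin_eq_sin_abs_of_abs_le_pi hu
    rw [e s hs, e t ht] at h
    linarith
  gcongr

lemma sub_sin_le {x : ℝ} (hx : |x| ≤ Real.pi) :
    x - Real.sin x ≤ Real.pi ^ 3 / 2 * (1 - Real.cos x) := by
  have hp := Real.pi_gt_three
  have hc : 0 ≤ 1 - Real.cos x := by linarith [Real.cos_le_one x]
  rcases le_total x 0 with h | h
  · have : -x ≥ Real.sin (-x) := Real.sin_le (by linarith)
    rw [Real.sin_neg] at this
    have : 0 ≤ Real.pi ^ 3 / 2 * (1 - Real.cos x) := by positivity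
    linarith
  · have h1 := Real.sin_ge_sub_cube h
    have h2 := cos_bound hx
    rw [abs_of_nonneg h] at hx
    have h3 : x ^ 3 ≤ Real.pi * x ^ 2 := by nlinarith [sq_nonneg x]
    have h4 : Real.pi * x ^ 2 ≤ Real.pi * (Real.pi ^ 2 / 2 * (1 - Real.cos x)) := by gcongr
    have : 0 ≤ x ^ 3 := by positivity
    nlinarith

lemma dir_pos {a : ℝ} (ha : |a| ≤ Real.pi) : ∃ C : ℝ, 0 ≤ C ∧ ∀ t : ℝ, 0 ≤ t → t ≤ Real.pi →
    t - |a| ≤ Real.sin (t - a) + C * (1 - Real.cos (t - a)) := by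
  have hp := Real.pi_pos
  rcases le_or_gt 0 a with h | h
  · refine ⟨Real.pi ^ 3 / 2, by positivity, fun t h0 h1 => ?_⟩
    rw [abs_of_nonneg h] at ha ⊢
    have := sub_sin_le (x := t - a) (by rw [abs_le]; constructor <;> linarith)
    linarith
  · rw [abs_of_neg h] at ha ⊢
    obtain ⟨b, rfl⟩ : ∃ b, a = -b := ⟨-a, by ring⟩
    rw [neg_neg] at ha
    simp only [neg_neg, sub_neg_eq_add]
    rcases eq_or_lt_of_le ha with hb | hb
    · subst hb
      refine ⟨0, le_rfl, fun t h0 h1 => ?_⟩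
      rw [Real.sin_add_pi, ← Real.sin_pi_sub]
      linarith [Real.sin_le (x := Real.pi - t) (by linarith)]
    · have hb0 : 0 < b := by linarith
      have hc : |Real.cos b| < 1 := by
        have hs : 0 < Real.sin b := Real.sin_pos_of_pos_of_lt_pi hb0 hb
        rw [abs_lt]
        constructor <;> nlinarith [Real.sin_sq_add_cos_sq b]
      refine ⟨(Real.pi + 1) / (1 - |Real.cos b|), div_nonneg (by linarith) (by linarith), fun t h0 h1 => ?_⟩
      have hcos : Real.cos (t + b) ≤ |Real.cos b| := by
        rcases le_total (t + b) Real.pi with h2 | h2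
        · exact (Real.cos_le_cos_of_nonneg_of_le_pi hb0.le h2 (by linarith)).trans (le_abs_self _)
        · have e : Real.cos (t + b) = Real.cos (2 * Real.pi - (t + b)) := by
            rw [Real.cos_two_pi_sub]
          rw [e]
          refine (Real.cos_le_cos_of_nonneg_of_le_pi (x := Real.pi - b) (by linarith) (by linarith) (by linarith)).trans ?_
          rw [Real.cos_pi_sub]
          exact neg_le_abs _
      have : Real.pi + 1 ≤ (Real.pi + 1) / (1 - |Real.cos b|) * (1 - Real.cos (t + b)) := by
        rw [div_mul_eq_mul_div, le_div_iff₀ (by linarith)]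
        gcongr
      linarith [Real.neg_one_le_sin (t + b)]

lemma dir_bound {a : ℝ} (ha : |a| ≤ Real.pi) : ∃ C : ℝ, 0 ≤ C ∧ ∀ t : ℝ, |t| ≤ Real.pi →
    |t| - |a| ≤ (if 0 ≤ t then 1 else -1) * Real.sin (t - a) + C * (1 - Real.cos (t - a)) := by
  obtain ⟨C, hC, h⟩ := dir_pos ha
  obtain ⟨C', hC', h'⟩ := dir_pos (a := -a) (by rwa [abs_neg])
  refine ⟨max C C', le_max_of_le_left hC, fun t ht => ?_⟩
  have hc : 0 ≤ 1 - Real.cos (t - a) := by linarith [Real.cos_le_one (t - a)]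
  split_ifs with h0
  · rw [abs_of_nonneg h0] at ht ⊢
    have := h t h0 ht
    have : C * (1 - Real.cos (t - a)) ≤ max C C' * (1 - Real.cos (t - a)) := by
      gcongr; exact le_max_left _ _
    linarith
  · push Not at h0
    rw [abs_of_neg h0] at ht ⊢
    have h2 := h' (-t) (by linarith) ht
    rw [show -t - -a = -(t - a) by ring, Real.sin_neg, Real.cos_neg, abs_neg] at h2
    have : C' * (1 - Real.cos (t - a)) ≤ max C C' * (1 - Real.cos (t - a)) := by
      gcongr; exact le_max_right _ _
    linarith

lemma Dg_mul_conj {n : ℕ} {X : Matrix (Fin n) (Fin n) ℂ} (hX : Xᴴ * X = 1) (hX' : X * Xᴴ = 1)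
    (θ : Fin n → ℝ) : Dg X θ * (Dg X θ)ᴴ = 1 ∧ (Dg X θ)ᴴ = Dg X (fun i => - θ i) := by
  have h : (Dg X θ)ᴴ = Dg X (fun i => - θ i) := by
    rw [Dg, Dg, conjTranspose_mul, conjTranspose_mul, conjTranspose_conjTranspose,
      diagonal_conjTranspose, mul_assoc]
    congr 4
    ext i
    change (starRingEnd ℂ) (Complex.exp (θ i * I)) = _
    rw [← Complex.exp_conj]
    simp
  refine ⟨?_, h⟩
  rw [h, Dg, Dg]
  calc _ = X * diagonal (fun j => Complex.exp (θ j * I)) * (Xᴴ * X)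
          * diagonal (fun j => Complex.exp ((-θ j : ℝ) * I)) * Xᴴ := by noncomm_ring
    _ = X * (diagonal (fun j => Complex.exp (θ j * I))
          * diagonal (fun j => Complex.exp ((-θ j : ℝ) * I))) * Xᴴ := by
        rw [hX]; noncomm_ring
    _ = 1 := by
        rw [diagonal_mul_diagonal]
        simp only [← Complex.exp_add]
        simp [hX']

lemma Dg_add {n : ℕ} {X : Matrix (Fin n) (Fin n) ℂ} (hX : Xᴴ * X = 1) 
    (κ : Fin n → ℝ) (s t : ℝ) :
    Dg X (fun j => s * κ j) * Dg X (fun j => t * κ j) = Dg X (fun j => (s + t) * κ j) := by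
  rw [Dg, Dg]
  calc _ = X * diagonal (fun j => Complex.exp ((s * κ j : ℝ) * I)) * (Xᴴ * X)
          * diagonal (fun j => Complex.exp ((t * κ j : ℝ) * I)) * Xᴴ := by noncomm_ring
    _ = X * (diagonal (fun j => Complex.exp ((s * κ j : ℝ) * I))
          * diagonal (fun j => Complex.exp ((t * κ j : ℝ) * I))) * Xᴴ := by
        rw [hX]; noncomm_ring
    _ = _ := by
        rw [diagonal_mul_diagonal]
        simp only [← Complex.exp_add, Dg]
        congr 4
        ext j
        congr 1
        push_cast; ring

/-- diagonal entries of a conjugated `Dg`. -/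
lemma diag_entry {n : ℕ} (Z : Matrix (Fin n) (Fin n) ℂ) (d : Fin n → ℂ) (i : Fin n) :
    (Zᴴ * diagonal d * Z) i i = ∑ j, (Complex.normSq (Z j i) : ℂ) * d j := by
  rw [mul_apply]
  refine Finset.sum_congr rfl fun j _ => ?_
  rw [mul_diagonal, conjTranspose_apply, Complex.normSq_eq_conj_mul_self]
  change (starRingEnd ℂ) (Z j i) * d j * Z j i = _
  ring

/-- The basic comparison: the eigenbases of `U`, `V`, `UV` are related by doubly stochastic
matrices. -/
lemma eigen_compare {n : ℕ} {X Y Q : Matrix (Fin n) (Fin n) ℂ}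
    (hX : Xᴴ * X = 1) (hX' : X * Xᴴ = 1) (hY : Yᴴ * Y = 1) (hY' : Y * Yᴴ = 1)
    (hQ : Qᴴ * Q = 1) (hQ' : Q * Qᴴ = 1) {θ α κ : Fin n → ℝ}
    (h : Dg Y α * Dg Q κ = Dg X θ) :
    ∃ P R : Matrix (Fin n) (Fin n) ℝ, P ∈ doublyStochastic ℝ (Fin n) ∧
      R ∈ doublyStochastic ℝ (Fin n) ∧ ∀ i,
      ∑ j, P i j * Real.cos (θ i - α j) = ∑ j, R i j * Real.cos (κ j) ∧
      ∑ j, P i j * Real.sin (θ i - α j) = ∑ j, R i j * Real.sin (κ j) := by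
  have hu : ∀ {A B : Matrix (Fin n) (Fin n) ℂ}, A * Aᴴ = 1 → Bᴴ * B = 1 →
      (Aᴴ * B)ᴴ * (Aᴴ * B) = 1 := by
    intro A B hA hB
    rw [conjTranspose_mul, conjTranspose_conjTranspose]
    calc Bᴴ * A * (Aᴴ * B) = Bᴴ * (A * Aᴴ) * B := by noncomm_ring
      _ = 1 := by rw [hA]; simpa using hB
  have hZ := hu hY' hX
  have hS := hu hQ' hX
  refine ⟨_, _, normSq_doubly hZ (mul_eq_one_comm.1 hZ), normSq_doubly hS (mul_eq_one_comm.1 hS), ?_⟩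
  intro i
  have e1 : Dg Q κ = (Dg Y α)ᴴ * Dg X θ := by
    rw [← h, ← mul_assoc, mul_eq_one_comm.1 (Dg_mul_conj hY hY' α).1, one_mul]
  have e2 : (Qᴴ * X)ᴴ * diagonal (fun j => Complex.exp (κ j * I)) * (Qᴴ * X) =
      (Yᴴ * X)ᴴ * diagonal (fun j => Complex.exp ((-α j : ℝ) * I)) * (Yᴴ * X)
        * diagonal (fun j => Complex.exp (θ j * I)) := by
    rw [(Dg_mul_conj hY hY' α).2] at e1
    have e3 := congrArg (fun M => Xᴴ * M * X) e1
    simp only [Dg] at e3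
    simp only [conjTranspose_mul, conjTranspose_conjTranspose]
    calc _ = Xᴴ * (Q * diagonal (fun j => Complex.exp (κ j * I)) * Qᴴ) * X := by noncomm_ring
      _ = _ := e3
      _ = (Xᴴ * Y * diagonal (fun j => Complex.exp ((-α j : ℝ) * I)) * (Yᴴ * X)
        * diagonal (fun j => Complex.exp (θ j * I))) * (Xᴴ * X) := by noncomm_ring
      _ = _ := by rw [hX, mul_one]
  have e3 := congrFun (congrFun e2 i) i
  rw [mul_diagonal, diag_entry, diag_entry, Finset.sum_mul] at e3
  have e4 : ∑ j, ((Complex.normSq ((Qᴴ * X) j i) : ℝ) : ℂ) * Complex.exp (κ j * I)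
      = ∑ j, ((Complex.normSq ((Yᴴ * X) j i) : ℝ) : ℂ) * Complex.exp ((θ i - α j : ℝ) * I) := by
    rw [e3]
    refine Finset.sum_congr rfl fun j _ => ?_
    rw [mul_assoc, ← Complex.exp_add]
    congr 2
    push_cast; ring
  constructor
  · have := congrArg Complex.re e4
    simp only [Complex.re_sum, Complex.re_ofReal_mul, Complex.exp_ofReal_mul_I_re] at this
    exact this.symm
  · have := congrArg Complex.im e4
    simp only [Complex.im_sum, Complex.im_ofReal_mul, Complex.exp_ofReal_mul_I_im] at this
    exact this.symm

/-- first order estimate -/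
lemma first_order {n : ℕ} {μ : Fin n → ℝ} (hμ : Antitone μ) (hμ0 : ∀ j, 0 ≤ μ j)
    {U : Matrix (Fin n) (Fin n) ℂ} (hU : U * Uᴴ = 1)
    {Q : Matrix (Fin n) (Fin n) ℂ} (hQ : Qᴴ * Q = 1) (hQ' : Q * Qᴴ = 1) {κ : Fin n → ℝ}
    (hκ : ∀ i, |κ i| ≤ Real.pi) (hκa : Antitone fun i => |κ i|) :
    (∃ C : ℝ, 0 ≤ C ∧ ∀ h : ℝ, 0 ≤ h →
      nu μ (U * Dg Q (fun j => h * κ j)) ≤ nu μ U + h * (∑ i, μ i * |κ i|) + C * h ^ 2) ∧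
    (∀ h : ℝ, nu μ (U * Dg Q (fun j => h * κ j)) ≤
        nu μ U + (∑ i, μ i) * (1 + Real.pi ^ 4 / 4) * |h|) := by
  obtain ⟨Y, α, hY, hY', hα, hαa, rfl⟩ := spectral hU
  have main : ∀ h : ℝ, ∃ (θ : Fin n → ℝ) (P R : Matrix (Fin n) (Fin n) ℝ),
      nu μ (Dg Y α * Dg Q (fun j => h * κ j)) = ∑ i, μ i * |θ i| ∧ (∀ i, |θ i| ≤ Real.pi) ∧
      P ∈ doublyStochastic ℝ (Fin n) ∧
      R ∈ doublyStochastic ℝ (Fin n) ∧ (∀ i,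
      |∑ j, P i j * Real.sin (θ i - α j)| ≤ |h| * ∑ j, R i j * |κ j|) ∧ 
      (∀ i, ∑ j, P i j * (1 - Real.cos (θ i - α j)) ≤ Real.pi ^ 2 / 2 * h ^ 2) := by
    intro h
    have hW : (Dg Y α * Dg Q (fun j => h * κ j)) * (Dg Y α * Dg Q (fun j => h * κ j))ᴴ = 1 := by
      rw [conjTranspose_mul]
      calc _ = Dg Y α * (Dg Q (fun j => h * κ j) * (Dg Q (fun j => h * κ j))ᴴ) * (Dg Y α)ᴴ := by
            noncomm_ring
        _ = 1 := by rw [(Dg_mul_conj hQ hQ' _).1, mul_one, (Dg_mul_conj hY hY' _).1]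
    obtain ⟨X, θ, hX, hX', hθ, hθa, e⟩ := spectral hW
    obtain ⟨P, R, hP, hR, hPR⟩ := eigen_compare hX hX' hY hY' hQ hQ' e
    have hPs := (mem_doublyStochastic_iff_sum.1 hP)
    have hRs := (mem_doublyStochastic_iff_sum.1 hR)
    refine ⟨θ, P, R, ?_, hθ, hP, hR, fun i => ?_, fun i => ?_⟩
    · rw [e, nu_Dg μ hX hθ hθa]
    · rw [(hPR i).2, Finset.mul_sum]
      refine (Finset.abs_sum_le_sum_abs _ _).trans (Finset.sum_le_sum fun j _ => ?_)
      rw [abs_mul, abs_of_nonneg (hRs.1 i j)]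
      have : |Real.sin (h * κ j)| ≤ |h| * |κ j| := by
        rw [← abs_mul]; exact Real.abs_sin_le_abs
      calc _ ≤ R i j * (|h| * |κ j|) := mul_le_mul_of_nonneg_left this (hRs.1 i j)
        _ = _ := by ring
    · have e1 : ∑ j, P i j * (1 - Real.cos (θ i - α j)) = ∑ j, R i j * (1 - Real.cos (h * κ j)) := by
        simp only [mul_sub, mul_one, Finset.sum_sub_distrib, hPs.2.1 i, hRs.2.1 i, (hPR i).1]
      rw [e1]
      calc _ ≤ ∑ j, R i j * (Real.pi ^ 2 / 2 * h ^ 2) := by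
            refine Finset.sum_le_sum fun j _ => mul_le_mul_of_nonneg_left ?_ (hRs.1 i j)
            have h1 := Real.one_sub_sq_div_two_le_cos (x := h * κ j)
            have h2 : κ j ^ 2 ≤ Real.pi ^ 2 := sq_le_sq.2 (by
              rw [abs_of_pos Real.pi_pos]; exact hκ j)
            have h3 : h ^ 2 * κ j ^ 2 ≤ h ^ 2 * Real.pi ^ 2 := by gcongr
            nlinarith
        _ = _ := by rw [← Finset.sum_mul, hRs.2.1 i, one_mul]
  rw [nu_Dg μ hY hα hαa]
  constructor
  · have hC : ∀ j, ∃ C : ℝ, 0 ≤ C ∧ ∀ t : ℝ, |t| ≤ Real.pi →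
      |t| - |α j| ≤ (if 0 ≤ t then 1 else -1) * Real.sin (t - α j) + C * (1 - Real.cos (t - α j)) :=
      fun j => dir_bound (hα j)
    choose C hC0 hC using hC
    set D := ∑ j, C j with hD
    have hD0 : 0 ≤ D := Finset.sum_nonneg fun j _ => hC0 j
    have hCD : ∀ j, C j ≤ D := fun j => Finset.single_le_sum (fun j _ => hC0 j) (Finset.mem_univ j)
    have hμs : 0 ≤ ∑ i, μ i := Finset.sum_nonneg fun j _ => hμ0 j
    refine ⟨(∑ i, μ i) * (D * (Real.pi ^ 2 / 2)), by positivity, fun h hh => ?_⟩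
    obtain ⟨θ, P, R, e, hθ, hP, hR, h1, h2⟩ := main h
    have hPs := (mem_doublyStochastic_iff_sum.1 hP)
    have hi : ∀ i, |θ i| ≤ ∑ j, P i j * |α j| + h * (∑ j, R i j * |κ j|)
        + D * (Real.pi ^ 2 / 2) * h ^ 2 := by
      intro i
      have a1 : |θ i| - ∑ j, P i j * |α j| = ∑ j, P i j * (|θ i| - |α j|) := by
        simp only [mul_sub, Finset.sum_sub_distrib, ← Finset.sum_mul, hPs.2.1 i, one_mul]
      have a2 : ∑ j, P i j * (|θ i| - |α j|) ≤ ∑ j, P i j *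
          ((if 0 ≤ θ i then 1 else -1) * Real.sin (θ i - α j) + D * (1 - Real.cos (θ i - α j))) := by
        refine Finset.sum_le_sum fun j _ => mul_le_mul_of_nonneg_left ?_ (hPs.1 i j)
        refine (hC j (θ i) (hθ i)).trans ?_
        have := Real.cos_le_one (θ i - α j)
        have : C j * (1 - Real.cos (θ i - α j)) ≤ D * (1 - Real.cos (θ i - α j)) :=
          mul_le_mul_of_nonneg_right (hCD j) (by linarith)
        linarith
      have a3 : ∑ j, P i j *
          ((if 0 ≤ θ i then 1 else -1) * Real.sin (θ i - α j) + D * (1 - Real.cos (θ i - α j)))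
          = (if 0 ≤ θ i then 1 else -1) * (∑ j, P i j * Real.sin (θ i - α j))
            + D * ∑ j, P i j * (1 - Real.cos (θ i - α j)) := by
        rw [Finset.mul_sum, Finset.mul_sum, ← Finset.sum_add_distrib]
        exact Finset.sum_congr rfl fun j _ => by ring
      have a4 : (if 0 ≤ θ i then 1 else -1) * (∑ j, P i j * Real.sin (θ i - α j))
          ≤ |∑ j, P i j * Real.sin (θ i - α j)| := by
        split_ifs
        · rw [one_mul]; exact le_abs_self _
        · rw [neg_one_mul]; exact neg_le_abs _
      have a5 := h1 i
      rw [abs_of_nonneg hh] at a5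
      have a6 := mul_le_mul_of_nonneg_left (h2 i) hD0
      linarith
    rw [e]
    calc ∑ i, μ i * |θ i| ≤ ∑ i, μ i * (∑ j, P i j * |α j| + h * (∑ j, R i j * |κ j|)
        + D * (Real.pi ^ 2 / 2) * h ^ 2) :=
          Finset.sum_le_sum fun i _ => mul_le_mul_of_nonneg_left (hi i) (hμ0 i)
      _ = (∑ i, μ i * ∑ j, P i j * |α j|) + h * (∑ i, μ i * ∑ j, R i j * |κ j|)
          + (∑ i, μ i) * (D * (Real.pi ^ 2 / 2)) * h ^ 2 := by
          simp only [mul_add, Finset.sum_add_distrib]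
          congr 1
          · congr 1
            rw [Finset.mul_sum]
            exact Finset.sum_congr rfl fun j _ => by ring
          · rw [← Finset.sum_mul]
            ring
      _ ≤ _ := by
          have b1 := doubly_rearr hμ hαa hP
          have b2 := mul_le_mul_of_nonneg_left (doubly_rearr hμ hκa hR) hh
          linarith
  · intro h
    obtain ⟨θ, P, R, e, hθ, hP, hR, h1, h2⟩ := main h
    have hPs := (mem_doublyStochastic_iff_sum.1 hP)
    have hi : ∀ i, |θ i| ≤ ∑ j, P i j * |α j| + (1 + Real.pi ^ 4 / 4) * |h| := by
      intro i
      have a1 : |θ i| - ∑ j, P i j * |α j| = ∑ j, P i j * (|θ i| - |α j|) := by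
        simp only [mul_sub, Finset.sum_sub_distrib, ← Finset.sum_mul, hPs.2.1 i, one_mul]
      set x := ∑ j, P i j * (|θ i| - |α j|) with hx
      have a2 : ∑ j, P i j * (|θ i| - |α j|) ^ 2 ≤ Real.pi ^ 4 / 4 * h ^ 2 := by
        calc _ ≤ ∑ j, P i j * (Real.pi ^ 2 / 2 * (1 - Real.cos (θ i - α j))) :=
              Finset.sum_le_sum fun j _ =>
                mul_le_mul_of_nonneg_left (abs_diff_sq (hθ i) (hα j)) (hPs.1 i j)
          _ = Real.pi ^ 2 / 2 * ∑ j, P i j * (1 - Real.cos (θ i - α j)) := by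
              rw [Finset.mul_sum]
              exact Finset.sum_congr rfl fun j _ => by ring
          _ ≤ Real.pi ^ 2 / 2 * (Real.pi ^ 2 / 2 * h ^ 2) :=
              mul_le_mul_of_nonneg_left (h2 i) (by positivity)
          _ = _ := by ring
      have a3 : |h| * x ≤ |h| ^ 2 + Real.pi ^ 4 / 4 * h ^ 2 := by
        calc |h| * x = ∑ j, P i j * (|h| * (|θ i| - |α j|)) := by
              rw [hx, Finset.mul_sum]
              exact Finset.sum_congr rfl fun j _ => by ring
          _ ≤ ∑ j, P i j * (|h| ^ 2 + (|θ i| - |α j|) ^ 2) := by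
              refine Finset.sum_le_sum fun j _ => mul_le_mul_of_nonneg_left ?_ (hPs.1 i j)
              nlinarith [sq_nonneg (|h| - (|θ i| - |α j|)), sq_nonneg (|h|), sq_nonneg (|θ i| - |α j|)]
          _ = |h| ^ 2 + ∑ j, P i j * (|θ i| - |α j|) ^ 2 := by
              simp only [mul_add, Finset.sum_add_distrib, ← Finset.sum_mul, hPs.2.1 i, one_mul]
          _ ≤ _ := by linarith
      have a4 : x ≤ (1 + Real.pi ^ 4 / 4) * |h| := by
        rcases eq_or_lt_of_le (abs_nonneg h) with h0 | h0
        · have h00 : h = 0 := by simpa using h0.symm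
          have : ∀ j ∈ Finset.univ, P i j * (|θ i| - |α j|) ^ 2 = 0 := by
            refine (Finset.sum_eq_zero_iff_of_nonneg fun j _ =>
              mul_nonneg (hPs.1 i j) (sq_nonneg _)).1 (le_antisymm (by simpa [h00] using a2)
                (Finset.sum_nonneg fun j _ => mul_nonneg (hPs.1 i j) (sq_nonneg _)))
          rw [← h0, mul_zero]
          refine le_of_eq (Finset.sum_eq_zero fun j hj => ?_)
          have := this j hj
          rcases mul_eq_zero.1 this with h | h
          · rw [h, zero_mul]
          · rw [pow_eq_zero_iff two_ne_zero] at h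
            rw [h, mul_zero]
        · rw [← sq_abs h] at a3
          refine le_of_mul_le_mul_left ?_ h0
          linarith
      linarith
    rw [e]
    calc ∑ i, μ i * |θ i| ≤ ∑ i, μ i * (∑ j, P i j * |α j| + (1 + Real.pi ^ 4 / 4) * |h|) :=
          Finset.sum_le_sum fun i _ => mul_le_mul_of_nonneg_left (hi i) (hμ0 i)
      _ = (∑ i, μ i * ∑ j, P i j * |α j|) + (∑ i, μ i) * (1 + Real.pi ^ 4 / 4) * |h| := by
          simp only [mul_add, Finset.sum_add_distrib]
          congr 1
          rw [← Finset.sum_mul]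
          ring
      _ ≤ _ := by
          have b1 := doubly_rearr hμ hαa hP
          linarith

lemma nu_mul_le {n : ℕ} {μ : Fin n → ℝ} (hμ : Antitone μ) (hμ0 : ∀ j, 0 ≤ μ j)
    {U V : Matrix (Fin n) (Fin n) ℂ} (hU : U * Uᴴ = 1) (hV : V * Vᴴ = 1) :
    nu μ (U * V) ≤ nu μ U + nu μ V := by
  obtain ⟨Q, κ, hQ, hQ', hκ, hκa, rfl⟩ := spectral hV
  rw [nu_Dg μ hQ hκ hκa]
  set L := ∑ i, μ i * |κ i| with hL
  let G : ℝ → Matrix (Fin n) (Fin n) ℂ := fun t => U * Dg Q (fun j => t * κ j)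
  have hG : ∀ t, G t * (G t)ᴴ = 1 := by
    intro t
    simp only [G]
    rw [conjTranspose_mul]
    calc _ = U * (Dg Q (fun j => t * κ j) * (Dg Q (fun j => t * κ j))ᴴ) * Uᴴ := by
          noncomm_ring
      _ = 1 := by rw [(Dg_mul_conj hQ hQ' _).1, mul_one, hU]
  have hGadd : ∀ t h, G (t + h) = G t * Dg Q (fun j => h * κ j) := by
    intro t h
    simp only [G]
    rw [mul_assoc, Dg_add hQ]
  let f : ℝ → ℝ := fun t => nu μ (G t)
  set M := (∑ i, μ i) * (1 + Real.pi ^ 4 / 4) with hM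
  have hμs : 0 ≤ ∑ i, μ i := Finset.sum_nonneg fun j _ => hμ0 j
  have hM0 : 0 ≤ M := by positivity
  have hlip : ∀ s t, f s ≤ f t + M * |s - t| := by
    intro s t
    have := (first_order hμ hμ0 (hG t) hQ hQ' hκ hκa).2 (s - t)
    rw [← hGadd, add_sub_cancel] at this
    exact this
  have hcont : Continuous f := by
    have : LipschitzWith ⟨M, hM0⟩ f := by
      refine LipschitzWith.of_le_add_mul _ fun s t => ?_
      rw [Real.dist_eq]
      exact hlip s t
    exact this.continuous
  have hder : ∀ t, ∃ C : ℝ, 0 ≤ C ∧ ∀ h : ℝ, 0 ≤ h → f (t + h) ≤ f t + h * L + C * h ^ 2 := by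
    intro t
    obtain ⟨C, hC, h⟩ := (first_order hμ hμ0 (hG t) hQ hQ' hκ hκa).1
    refine ⟨C, hC, fun s hs => ?_⟩
    have := h s hs
    rw [← hGadd] at this
    exact this
  have hB : ∀ x, HasDerivAt (fun t => f 0 + t * L) L x := fun x => by
    simpa using ((hasDerivAt_id x).mul_const L).const_add (f 0)
  have key := image_le_of_liminf_slope_right_le_deriv_boundary (f := f) (a := 0) (b := 1)
    (B := fun t => f 0 + t * L) (B' := fun _ => L) hcont.continuousOn (by simp)
    (by fun_prop) (fun x _ => (hB x).hasDerivWithinAt) (by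
      intro x _ r hr
      apply Filter.Eventually.frequently
      obtain ⟨C, hC, h⟩ := hder x
      have hpos : 0 < (r - L) / (C + 1) := div_pos (by linarith) (by linarith)
      filter_upwards [Ioo_mem_nhdsGT (show x < x + (r - L) / (C + 1) by linarith)] with z hz
      have hz1 : 0 < z - x := by linarith [hz.1]
      have hz2 : z - x < (r - L) / (C + 1) := by linarith [hz.2]
      rw [lt_div_iff₀ (by linarith)] at hz2
      have := h (z - x) hz1.le
      rw [add_sub_cancel] at this
      rw [slope_def_field, div_lt_iff₀ hz1]
      nlinarith)
  have := key (x := 1) (by simp)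
  simp only [one_mul] at this
  have e0 : G 0 = U := by simp [G, Dg, hQ']
  have e1 : G 1 = U * Dg Q κ := by simp [G]
  simpa only [f, e0, e1] using this

theorem stmt5 {n : ℕ} (μ : Fin n → ℝ) (hμ : Antitone μ) (hμ0 : ∀ j, 0 ≤ μ j)
    (hμne : μ ≠ 0)
    (d : Matrix.unitaryGroup (Fin n) ℂ → Matrix.unitaryGroup (Fin n) ℂ → ℝ)
    (hd : ∀ U V : Matrix.unitaryGroup (Fin n) ℂ,
      d U V = nu μ ((U * V⁻¹ : Matrix.unitaryGroup (Fin n) ℂ) : Matrix (Fin n) (Fin n) ℂ)) :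
    (∀ U V, 0 ≤ d U V) ∧ (∀ U V, d U V = 0 ↔ U = V) ∧ (∀ U V, d U V = d V U) ∧
      (∀ U V W, d U W ≤ d U V + d V W) := by
  have hun : ∀ A : Matrix.unitaryGroup (Fin n) ℂ,
      (A : Matrix (Fin n) (Fin n) ℂ) * (A : Matrix (Fin n) (Fin n) ℂ)ᴴ = 1 :=
    fun A => Unitary.coe_mul_star_self A
  have hinv : ∀ A : Matrix.unitaryGroup (Fin n) ℂ,
      ((A⁻¹ : Matrix.unitaryGroup (Fin n) ℂ) : Matrix (Fin n) (Fin n) ℂ)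
        = (A : Matrix (Fin n) (Fin n) ℂ)ᴴ := fun A => rfl
  refine ⟨fun U V => ?_, fun U V => ?_, fun U V => ?_, fun U V W => ?_⟩
  · obtain ⟨X, θ, hX, hX', hθ, hθa, e⟩ := spectral (hun (U * V⁻¹))
    rw [hd, e, nu_Dg μ hX hθ hθa]
    exact Finset.sum_nonneg fun i _ => mul_nonneg (hμ0 i) (abs_nonneg _)
  · obtain ⟨X, θ, hX, hX', hθ, hθa, e⟩ := spectral (hun (U * V⁻¹))
    have hiff : U = V ↔ ((U * V⁻¹ : Matrix.unitaryGroup (Fin n) ℂ) : Matrix (Fin n) (Fin n) ℂ) = 1 := by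
      rw [← mul_inv_eq_one, ← OneMemClass.coe_eq_one]
    rw [hd, hiff, e, nu_Dg μ hX hθ hθa]
    constructor
    · intro h
      have h1 := (Finset.sum_eq_zero_iff_of_nonneg fun i _ =>
        mul_nonneg (hμ0 i) (abs_nonneg (θ i))).1 h
      obtain ⟨k, hk⟩ := Function.ne_iff.1 hμne
      have hn : 0 < n := k.pos
      let z : Fin n := ⟨0, hn⟩
      have hz : ∀ i, z ≤ i := fun i => Fin.mk_le_of_le_val (Nat.zero_le _)
      have hμz : 0 < μ z := by
        have h2 : 0 < μ k := lt_of_le_of_ne (hμ0 k) (Ne.symm hk)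
        exact h2.trans_le (hμ (hz k))
      have hθz : |θ z| = 0 := by
        rcases mul_eq_zero.1 (h1 z (Finset.mem_univ _)) with h | h
        · exact absurd h hμz.ne'
        · exact h
      have hθ0 : ∀ i, θ i = 0 := fun i => by
        have : |θ i| ≤ |θ z| := hθa (hz i)
        rw [hθz] at this
        exact abs_nonpos_iff.1 this
      simp [Dg, hθ0, hX']
    · intro h
      have h1 : diagonal (fun j => Complex.exp (θ j * I)) = 1 := by
        have := congrArg (fun M => Xᴴ * M * X) h
        simp only [Dg, mul_one, hX] at this
        rw [← this]
        calc diagonal (fun j => Complex.exp (θ j * I))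
            = (Xᴴ * X) * diagonal (fun j => Complex.exp (θ j * I)) * (Xᴴ * X) := by simp [hX]
          _ = _ := by noncomm_ring
      refine Finset.sum_eq_zero fun i _ => ?_
      have h2 := congrFun (congrFun h1 i) i
      rw [diagonal_apply_eq, one_apply_eq] at h2
      rw [← abs_arg_exp (hθ i), h2]
      simp
  · obtain ⟨X, θ, hX, hX', hθ, hθa, e⟩ := spectral (hun (U * V⁻¹))
    have e2 : ((V * U⁻¹ : Matrix.unitaryGroup (Fin n) ℂ) : Matrix (Fin n) (Fin n) ℂ)
        = Dg X (fun i => - θ i) := by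
      rw [← (Dg_mul_conj hX hX' θ).2, ← e, ← hinv, _root_.mul_inv_rev, inv_inv]
    rw [hd, hd, e, e2, nu_Dg μ hX hθ hθa, nu_Dg μ hX (by simpa using hθ) (by simpa using hθa)]
    simp
  · rw [hd, hd, hd]
    have : U * W⁻¹ = (U * V⁻¹) * (V * W⁻¹) := by group
    rw [this]
    exact nu_mul_le hμ hμ0 (hun _) (hun _)
end
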